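/- arXiv:math/0406093 — 3 statements merged into one kernel-verified Lean document; each statement's English description precedes it below -/
import Mathlib

section
/- If n ≥ 2 and a continuous map f : ℂⁿ → ℂⁿ preserves unit distance (i.e., preserves distance 1), then there exist an affine map I : ℂⁿ → ℂⁿ with orthogonal linear part and ρ ∈ {id_ℂ, τ} such that f = I ∘ (ρ,...,ρ), where (ρ,...,ρ) acts coordinatewise. -/
/-- φ_n(X,Y) = Σ_{i=1}^n (x_i − y_i)². -/
noncomputable def phi (n : ℕ) (X Y : Fin n → ℂ) : ℂ := ∑ i, (X i - Y i) ^ 2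

open Matrix

theorem phi_eq (n : ℕ) (X Y : Fin n → ℂ) : phi n X Y = (X - Y) ⬝ᵥ (X - Y) := by
  simp [phi, dotProduct, sq]

theorem phi_comm (n : ℕ) (X Y : Fin n → ℂ) : phi n X Y = phi n Y X := by
  unfold phi; exact Finset.sum_congr rfl (fun i _ => by ring)

/-- Affine complex isometries. -/
structure Isom (n : ℕ) where
  L : Matrix (Fin n) (Fin n) ℂ
  hL : Lᵀ * L = 1
  t : Fin n → ℂ

namespace Isom

def app {n : ℕ} (g : Isom n) (z : Fin n → ℂ) : Fin n → ℂ := g.L *ᵥ z + g.t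

def inv {n : ℕ} (g : Isom n) (z : Fin n → ℂ) : Fin n → ℂ := g.Lᵀ *ᵥ (z - g.t)

theorem inv_app {n : ℕ} (g : Isom n) (z : Fin n → ℂ) : g.inv (g.app z) = z := by
  simp [inv, app, g.hL]

theorem app_inv {n : ℕ} (g : Isom n) (z : Fin n → ℂ) : g.app (g.inv z) = z := by
  have := mul_eq_one_comm.mp g.hL
  simp [inv, app, this]

theorem phi_app {n : ℕ} (g : Isom n) (x y : Fin n → ℂ) :
    phi n (g.app x) (g.app y) = phi n x y := by
  have h : g.app x - g.app y = g.L *ᵥ (x - y) := by simp [app, mulVec_sub]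
  rw [phi_eq, phi_eq, h, dotProduct_mulVec, vecMul_mulVec, g.hL, dotProduct_comm]
  simp

theorem phi_inv {n : ℕ} (g : Isom n) (x y : Fin n → ℂ) :
    phi n (g.inv x) (g.inv y) = phi n x y := by
  rw [← g.phi_app, g.app_inv, g.app_inv]

theorem continuous_inv {n : ℕ} (g : Isom n) : Continuous g.inv := by
  unfold inv
  exact Continuous.matrix_mulVec continuous_const (by fun_prop)

end Isom

theorem polar (n : ℕ) (x p q : Fin n → ℂ) :
    (p - x) ⬝ᵥ (q - x) = (phi n p x + phi n q x - phi n p q) / 2 := by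
  rw [phi, phi, phi, ← Finset.sum_add_distrib, ← Finset.sum_sub_distrib, Finset.sum_div]
  unfold dotProduct
  exact Finset.sum_congr rfl (fun i _ => by simp only [Pi.sub_apply]; ring)

theorem exists_isom_frame {n : ℕ} (x X : Fin n → ℂ) (p P : Fin n → Fin n → ℂ)
    (hM : ∀ v, (∀ i, (p i - x) ⬝ᵥ v = 0) → v = 0)
    (h1 : ∀ i, phi n (P i) X = phi n (p i) x)
    (h2 : ∀ i j, phi n (P i) (P j) = phi n (p i) (p j)) :
    ∃ g : Isom n, g.app x = X ∧ ∀ i, g.app (p i) = P i := by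
  let M : Matrix (Fin n) (Fin n) ℂ := Matrix.of fun i => p i - x
  let M' : Matrix (Fin n) (Fin n) ℂ := Matrix.of fun i => P i - X
  have hMM : M' * M'ᵀ = M * Mᵀ := by
    ext i j
    change (P i - X) ⬝ᵥ (P j - X) = (p i - x) ⬝ᵥ (p j - x)
    rw [polar, polar, h1, h1, h2]
  have hdet : IsUnit M.det := by
    rw [isUnit_iff_ne_zero]
    intro h0
    obtain ⟨v, hv, hv0⟩ := Matrix.exists_mulVec_eq_zero_iff.mpr h0
    exact hv (hM v fun i => congrFun hv0 i)
  have hdetT : IsUnit Mᵀ.det := by rwa [det_transpose]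
  let L := M'ᵀ * (Mᵀ)⁻¹
  have hLM : L * Mᵀ = M'ᵀ := by
    simp only [L]; rw [Matrix.mul_assoc, Matrix.nonsing_inv_mul _ hdetT, Matrix.mul_one]
  have hL : Lᵀ * L = 1 := by
    have : Lᵀ * L = M⁻¹ * (M' * M'ᵀ) * (Mᵀ)⁻¹ := by
      simp only [L, transpose_mul, transpose_transpose, transpose_nonsing_inv, Matrix.mul_assoc]
    rw [this, hMM, ← Matrix.mul_assoc, Matrix.nonsing_inv_mul _ hdet, Matrix.one_mul,
      Matrix.mul_nonsing_inv _ hdetT]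
  refine ⟨⟨L, hL, X - L *ᵥ x⟩, ?_, ?_⟩
  · simp [Isom.app]
  · intro i
    have : L *ᵥ (p i - x) = P i - X := by
      ext k
      exact congrFun (congrFun hLM k) i
    rw [mulVec_sub] at this
    simp only [Isom.app]
    rw [← sub_add_cancel (P i) X, ← this]
    abel

theorem reflect_orth {n : ℕ} (w : Fin n → ℂ) (hw : w ⬝ᵥ w ≠ 0) :
    ((1 : Matrix (Fin n) (Fin n) ℂ) - (2 / (w ⬝ᵥ w)) • vecMulVec w w)ᵀ *
      (1 - (2 / (w ⬝ᵥ w)) • vecMulVec w w) = 1 := by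
  have h1 : (vecMulVec w w)ᵀ = vecMulVec w w := by
    ext i j; simp [vecMulVec_apply, mul_comm]
  have h2 : vecMulVec w w * vecMulVec w w = (w ⬝ᵥ w) • vecMulVec w w := by
    rw [vecMulVec_mul_vecMulVec]
    ext i j; simp [vecMulVec_apply, mul_comm, mul_left_comm]
  rw [transpose_sub, transpose_smul, h1, transpose_one, Matrix.sub_mul, Matrix.mul_sub,
    Matrix.smul_mul, Matrix.mul_sub, Matrix.mul_smul, Matrix.mul_smul, h2, smul_smul]
  simp only [Matrix.one_mul, Matrix.mul_one]
  rw [div_mul_cancel₀ _ hw, smul_sub, smul_smul]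
  ext i j
  simp only [Matrix.sub_apply, Matrix.smul_apply, smul_eq_mul]
  ring

theorem reflect_mulVec {n : ℕ} (w u : Fin n → ℂ) :
    ((1 : Matrix (Fin n) (Fin n) ℂ) - (2 / (w ⬝ᵥ w)) • vecMulVec w w) *ᵥ u =
      u - (2 * (w ⬝ᵥ u) / (w ⬝ᵥ w)) • w := by
  rw [sub_mulVec, one_mulVec, smul_mulVec, vecMulVec_mulVec]
  ext i
  simp
  ring

theorem exists_orth {n : ℕ} (u v : Fin n → ℂ) (huv : u ⬝ᵥ u = v ⬝ᵥ v) (hu : u ⬝ᵥ u ≠ 0) :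
    ∃ L : Matrix (Fin n) (Fin n) ℂ, Lᵀ * L = 1 ∧ L *ᵥ u = v := by
  by_cases h : (u - v) ⬝ᵥ (u - v) = 0
  · have h' : (u + v) ⬝ᵥ (u + v) = 2 * ((u + v) ⬝ᵥ u) := by
      simp only [add_dotProduct, dotProduct_add, dotProduct_comm v u, ← huv]; ring
    have h'' : (u + v) ⬝ᵥ (u + v) ≠ 0 := by
      intro h0
      apply hu
      simp only [sub_dotProduct, dotProduct_sub, add_dotProduct, dotProduct_add,
        dotProduct_comm v u, ← huv] at h h0
      linear_combination (h + h0) / 4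
    refine ⟨-(1 - (2 / ((u + v) ⬝ᵥ (u + v))) • vecMulVec (u + v) (u + v)), ?_, ?_⟩
    · rw [transpose_neg, neg_mul_neg, reflect_orth _ h'']
    · rw [neg_mulVec, reflect_mulVec, ← h', div_self h'', one_smul]; abel
  · have h' : (u - v) ⬝ᵥ (u - v) = 2 * ((u - v) ⬝ᵥ u) := by
      simp only [sub_dotProduct, dotProduct_sub, dotProduct_comm v u, ← huv]; ring
    refine ⟨1 - (2 / ((u - v) ⬝ᵥ (u - v))) • vecMulVec (u - v) (u - v), reflect_orth _ h, ?_⟩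
    rw [reflect_mulVec, ← h', div_self h, one_smul]; abel

theorem exists_isom_pair {n : ℕ} (x y x' y' : Fin n → ℂ) (h : phi n x y = phi n x' y')
    (h0 : phi n x y ≠ 0) : ∃ g : Isom n, g.app x = x' ∧ g.app y = y' := by
  rw [phi_eq, phi_eq] at h
  rw [phi_eq] at h0
  obtain ⟨L, hL, hLu⟩ := exists_orth _ _ h h0
  refine ⟨⟨L, hL, x' - L *ᵥ x⟩, by simp [Isom.app], ?_⟩
  rw [mulVec_sub] at hLu
  simp only [Isom.app]
  have : y' = x' - (x' - y') := by abel
  rw [this, ← hLu]; abel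

/-- `f` preserves the squared distance `s`. -/
def Pres {n : ℕ} (f : (Fin n → ℂ) → (Fin n → ℂ)) (s : ℂ) : Prop :=
  ∀ X Y, phi n X Y = s → phi n (f X) (f Y) = s

theorem Pres.comp_app {n : ℕ} {f : (Fin n → ℂ) → (Fin n → ℂ)} {s : ℂ} (h : Pres f s)
    (g : Isom n) : Pres (fun x => f (g.app x)) s :=
  fun X Y hXY => h _ _ (by rw [g.phi_app, hXY])

theorem Pres.inv_comp {n : ℕ} {f : (Fin n → ℂ) → (Fin n → ℂ)} {s : ℂ} (h : Pres f s)
    (g : Isom n) : Pres (fun x => g.inv (f x)) s :=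
  fun X Y hXY => by simp only; rw [g.phi_inv, h _ _ hXY]

/-- Points in the distinguished plane. -/
def PP (m : ℕ) (a b : ℂ) : Fin (m + 1) → ℂ := Fin.cons a (fun _ => b)

/-- Vertices of the distinguished face. -/
def FF (m : ℕ) (s : ℂ) (i : Fin m) : Fin (m + 1) → ℂ := Fin.cons 0 (Pi.single i s)

theorem phi_PP (m : ℕ) (a b a' b' : ℂ) :
    phi (m + 1) (PP m a b) (PP m a' b') = (a - a') ^ 2 + m * (b - b') ^ 2 := by
  simp [phi, PP, Fin.sum_univ_succ]

theorem phi_YF (m : ℕ) (s : ℂ) (Y : Fin (m + 1) → ℂ) (i : Fin m) :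
    phi (m + 1) Y (FF m s i) = Y 0 ^ 2 + ∑ j : Fin m, Y j.succ ^ 2 - 2 * s * Y i.succ + s ^ 2 := by
  have : ∑ j : Fin m, (Y j.succ - (Pi.single i s : Fin m → ℂ) j) ^ 2 =
      ∑ j : Fin m, Y j.succ ^ 2 - 2 * s * Y i.succ + s ^ 2 := by
    have h : ∀ j : Fin m, (Y j.succ - (Pi.single i s : Fin m → ℂ) j) ^ 2 =
        Y j.succ ^ 2 + (if j = i then (- 2 * s * Y i.succ + s ^ 2) else 0) := by
      intro j
      by_cases hj : j = i
      · subst hj; simp; ring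
      · simp [hj]
    rw [Finset.sum_congr rfl (fun j _ => h j), Finset.sum_add_distrib]
    simp; ring
  simp only [phi, Fin.sum_univ_succ, FF, Fin.cons_zero, Fin.cons_succ]
  rw [this]; ring

theorem phi_PF (m : ℕ) (s a b : ℂ) (i : Fin m) :
    phi (m + 1) (PP m a b) (FF m s i) = a ^ 2 + m * b ^ 2 - 2 * s * b + s ^ 2 := by
  rw [phi_YF]; simp [PP]

theorem phi_FF (m : ℕ) (s : ℂ) (i j : Fin m) :
    phi (m + 1) (FF m s i) (FF m s j) = if i = j then 0 else 2 * s ^ 2 := by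
  rw [phi_YF]
  split_ifs with h
  · subst h; simp [FF, Pi.single_apply]; ring
  · simp [FF, Pi.single_apply, Ne.symm h]; ring

/-- The points of the distinguished circle. -/
noncomputable def XX (m : ℕ) (s w r φ : ℂ) : Fin (m + 1) → ℂ :=
  PP m (r * Complex.cos φ) (s / m + r / w * Complex.sin φ)

section circle

variable {m : ℕ} (hm : 1 ≤ m) {s w r : ℂ} (hs : s ^ 2 = 1 / 2) (hw : w ^ 2 = m) (hr : r ≠ 0)

theorem w_ne (hm : 1 ≤ m) (hw : w ^ 2 = m) : w ≠ 0 := by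
  rintro rfl
  have : (m : ℂ) ≠ 0 := by exact_mod_cast (by omega : m ≠ 0)
  apply this; rw [← hw]; simp

theorem phi_XX (hm : 1 ≤ m) (hw : w ^ 2 = m) (φ ψ : ℂ) :
    phi (m + 1) (XX m s w r φ) (XX m s w r ψ) = 2 * r ^ 2 * (1 - Complex.cos (φ - ψ)) := by
  have hw0 := w_ne hm hw
  rw [XX, XX, phi_PP, ← hw, Complex.cos_sub]
  field_simp
  linear_combination w ^ 2 * r ^ 2 * Complex.cos_sq_add_sin_sq φ +
    w ^ 2 * r ^ 2 * Complex.cos_sq_add_sin_sq ψ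

theorem phi_XF (hm : 1 ≤ m) (hs : s ^ 2 = 1 / 2) (hw : w ^ 2 = m) (φ : ℂ) (i : Fin m) :
    phi (m + 1) (XX m s w r φ) (FF m s i) = r ^ 2 + 1 / 2 - 1 / (2 * m) := by
  have hw0 := w_ne hm hw
  rw [XX, phi_PF, ← hw]
  have := Complex.cos_sq_add_sin_sq φ
  field_simp
  linear_combination (2 * w^2 * r ^ 2) * this + (-2 + 2 * w ^ 2) * hs

theorem uniq (hm : 1 ≤ m) (hs : s ^ 2 = 1 / 2) (hw : w ^ 2 = m) (hr : r ≠ 0)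
    (Y : Fin (m + 1) → ℂ) (φ θ : ℂ)
    (h1 : ∀ i, phi (m + 1) Y (FF m s i) = r ^ 2 + 1 / 2 - 1 / (2 * m))
    (h2 : phi (m + 1) Y (XX m s w r φ) = 2 * r ^ 2 * (1 - Complex.cos θ)) :
    Y = XX m s w r (φ + θ) ∨ Y = XX m s w r (φ - θ) := by
  have hw0 := w_ne hm hw
  have hs0 : s ≠ 0 := by rintro rfl; norm_num at hs
  let i0 : Fin m := ⟨0, hm⟩
  have hY : Y = PP m (Y 0) (Y i0.succ) := by
    ext j
    refine Fin.cases (by simp [PP]) (fun i => ?_) j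
    simp only [PP, Fin.cons_succ]
    have a := h1 i
    have b := h1 i0
    rw [phi_YF] at a b
    exact mul_left_cancel₀ hs0 (by linear_combination (b - a) / 2)
  generalize Y 0 = a at hY
  generalize Y i0.succ = b at hY
  subst hY
  have h1 := h1 i0
  rw [phi_PF, ← hw] at h1
  rw [XX, phi_PP, ← hw] at h2
  obtain ⟨α, rfl⟩ : ∃ α, a = r * α := ⟨a / r, by field_simp⟩
  obtain ⟨δ, rfl⟩ : ∃ δ, b = s / m + r / w * δ := ⟨(b - s / m) * w / r, by field_simp; ring⟩
  rw [← hw] at h1 h2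
  have e1 : α ^ 2 + δ ^ 2 = 1 := by
    field_simp at h1
    have : (2 * w ^ 2 * r ^ 2) * (α ^ 2 + δ ^ 2) = (2 * w ^ 2 * r ^ 2) * 1 := by
      linear_combination h1 - (-2 + 2 * w ^ 2) * hs
    exact mul_left_cancel₀ (by simp [hw0, hr]) this
  have hc := Complex.cos_sq_add_sin_sq φ
  have e2 : α * Complex.cos φ + δ * Complex.sin φ = Complex.cos θ := by
    field_simp at h2
    exact mul_left_cancel₀ (a := 2 * r ^ 2 * w ^ 2) (by simp [hw0, hr])
      (by linear_combination r ^ 2 * w ^ 2 * e1 + r ^ 2 * w ^ 2 * hc - h2)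
  have e3 : (-α * Complex.sin φ + δ * Complex.cos φ) ^ 2 = Complex.sin θ ^ 2 := by
    rw [Complex.sin_sq, ← e2]
    linear_combination e1 * (Complex.cos φ ^ 2 + Complex.sin φ ^ 2) + hc
  rcases sq_eq_sq_iff_eq_or_eq_neg.mp e3 with e | e
  · left
    have ha : α = Complex.cos (φ + θ) := by
      rw [Complex.cos_add, ← e, ← e2]; linear_combination -α * hc
    have hb : δ = Complex.sin (φ + θ) := by
      rw [Complex.sin_add, ← e, ← e2]; linear_combination -δ * hc
    rw [XX, ha, hb]
  · right
    have e' : Complex.sin θ = -(-α * Complex.sin φ + δ * Complex.cos φ) := by rw [e]; ring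
    have ha : α = Complex.cos (φ - θ) := by
      rw [Complex.cos_sub, e', ← e2]; linear_combination -α * hc
    have hb : δ = Complex.sin (φ - θ) := by
      rw [Complex.sin_sub, e', ← e2]; linear_combination -δ * hc
    rw [XX, ha, hb]

theorem exists_frame (hm : 1 ≤ m) (hs : s ^ 2 = 1 / 2) (hw : w ^ 2 = m) (hr : r ≠ 0) {θ : ℂ}
    (hθ : Complex.sin θ ≠ 0) {f : (Fin (m + 1) → ℂ) → (Fin (m + 1) → ℂ)} (hf1 : Pres f 1)
    (hfB : Pres f (r ^ 2 + 1 / 2 - 1 / (2 * m)))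
    (hfC : Pres f (2 * r ^ 2 * (1 - Complex.cos θ))) :
    ∃ g : Isom (m + 1), g.app (XX m s w r 0) = f (XX m s w r 0) ∧
      g.app (XX m s w r θ) = f (XX m s w r θ) ∧ ∀ i, g.app (FF m s i) = f (FF m s i) := by
  have hw0 := w_ne hm hw
  have hs0 : s ≠ 0 := by rintro rfl; norm_num at hs
  have hm0 : (m : ℂ) ≠ 0 := by rw [← hw]; positivity
  let p : Fin (m + 1) → Fin (m + 1) → ℂ := Fin.cons (XX m s w r θ) (fun i => FF m s i)
  have hBs : ∀ φ i, phi (m + 1) (f (XX m s w r φ)) (f (FF m s i)) =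
      phi (m + 1) (XX m s w r φ) (FF m s i) := by
    intro φ i
    rw [phi_XF hm hs hw, hfB _ _ (phi_XF hm hs hw φ i)]
  have hFs : ∀ i j, phi (m + 1) (f (FF m s i)) (f (FF m s j)) =
      phi (m + 1) (FF m s i) (FF m s j) := by
    intro i j
    by_cases h : i = j
    · subst h; simp [phi]
    · have : phi (m + 1) (FF m s i) (FF m s j) = 1 := by rw [phi_FF, if_neg h, hs]; norm_num
      rw [this, hf1 _ _ this]
  have hC : phi (m + 1) (XX m s w r θ) (XX m s w r 0) = 2 * r ^ 2 * (1 - Complex.cos θ) := by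
    rw [phi_XX hm hw, sub_zero]
  have key := exists_isom_frame (XX m s w r 0) (f (XX m s w r 0)) p
    (fun i => f (p i)) ?_ ?_ ?_
  · obtain ⟨g, hg0, hg⟩ := key
    exact ⟨g, hg0, hg 0, fun i => hg i.succ⟩
  · intro v hv
    have h0 := hv 0
    have hi : ∀ i : Fin m, (FF m s i - XX m s w r 0) ⬝ᵥ v = 0 := fun i => hv i.succ
    simp only [p, Fin.cons_zero] at h0
    have hi' : ∀ i : Fin m, s * v i.succ = r * v 0 + s / m * ∑ j : Fin m, v j.succ := by
      intro i
      have := hi i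
      simp only [sub_dotProduct] at this
      simp only [FF, XX, PP, dotProduct, Fin.sum_univ_succ, Fin.cons_zero, Fin.cons_succ,
        Pi.single_apply, ite_mul, zero_mul, Finset.sum_ite_eq', Finset.mem_univ, if_true,
        Complex.cos_zero, Complex.sin_zero, mul_zero, add_zero, ← Finset.mul_sum] at this
      linear_combination this
    have hv0 : v 0 = 0 := by
      have : ∑ i : Fin m, s * v i.succ = ∑ i : Fin m, (r * v 0 + s / m * ∑ j : Fin m, v j.succ) :=
        Finset.sum_congr rfl fun i _ => hi' i
      rw [← Finset.mul_sum] at this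
      simp at this
      field_simp at this
      have h3 : (m : ℂ) * r * v 0 = 0 := by linear_combination -this
      simpa [hm0, hr] using h3
    have hsum : ∑ j : Fin m, v j.succ = 0 := by
      simp only [sub_dotProduct] at h0
      simp only [FF, XX, PP, dotProduct, Fin.sum_univ_succ, Fin.cons_zero, Fin.cons_succ, hv0,
        Complex.cos_zero, Complex.sin_zero, mul_zero, add_zero, zero_add, ← Finset.mul_sum] at h0
      have h3 : r / w * Complex.sin θ * ∑ j : Fin m, v j.succ = 0 := by linear_combination h0
      simpa [hr, hw0, hθ] using h3
    ext j
    refine Fin.cases hv0 (fun i => ?_) j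
    have := hi' i
    rw [hv0, hsum] at this
    simpa [hs0] using this
  · intro i
    refine Fin.cases ?_ (fun i => ?_) i
    · simp only [p, Fin.cons_zero]
      rw [hC, hfC _ _ hC]
    · simp only [p, Fin.cons_succ]
      rw [phi_comm, hBs, phi_comm]
  · intro i j
    refine Fin.cases ?_ (fun i => ?_) i <;> refine Fin.cases ?_ (fun j => ?_) j <;>
      simp only [p, Fin.cons_zero, Fin.cons_succ]
    · simp [phi]
    · rw [hBs]
    · rw [phi_comm, hBs, phi_comm]
    · rw [hFs]

theorem next_pt (hm : 1 ≤ m) (hs : s ^ 2 = 1 / 2) (hw : w ^ 2 = m) (hr : r ≠ 0) {θ : ℂ}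
    {f : (Fin (m + 1) → ℂ) → (Fin (m + 1) → ℂ)}
    (hfB : Pres f (r ^ 2 + 1 / 2 - 1 / (2 * m)))
    (hfC : Pres f (2 * r ^ 2 * (1 - Complex.cos θ))) (g : Isom (m + 1))
    (hg : ∀ i, g.app (FF m s i) = f (FF m s i)) (φ : ℂ)
    (hgφ : g.app (XX m s w r φ) = f (XX m s w r φ)) :
    f (XX m s w r (φ + θ)) = g.app (XX m s w r (φ + θ)) ∨
    f (XX m s w r (φ + θ)) = g.app (XX m s w r (φ - θ)) := by
  have := uniq hm hs hw hr (g.inv (f (XX m s w r (φ + θ)))) φ θ ?_ ?_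
  · rcases this with h | h
    · left; conv_rhs => rw [← h, g.app_inv]
    · right; conv_rhs => rw [← h, g.app_inv]
  · intro i
    rw [← g.phi_app, g.app_inv, hg, hfB _ _ (phi_XF hm hs hw _ _)]
  · rw [← g.phi_app, g.app_inv, hgφ]
    apply hfC
    rw [phi_XX hm hw]; congr 3; ring

theorem spindle (hm : 1 ≤ m) (hw : w ^ 2 = m) {f : (Fin (m + 1) → ℂ) → (Fin (m + 1) → ℂ)}
    (hf1 : Pres f 1) {D : ℂ} (hD0 : D ≠ 0) (hD1 : D ≠ 1)
    (h : ∀ x y, phi (m + 1) x y = D → f x = f y ∨ phi (m + 1) (f x) (f y) = D) : Pres f D := by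
  intro x y hxy
  rcases h x y hxy with h1 | h1
  swap
  · exact h1
  exfalso
  have hw0 := w_ne hm hw
  obtain ⟨d, hd⟩ := IsSquare.exists_sq D (IsAlgClosed.exists_pow_nat_eq D two_pos |>.elim
    fun z hz => ⟨z, by rw [← hz, sq]⟩)
  obtain ⟨β, hβ⟩ := IsAlgClosed.exists_pow_nat_eq (1 - (1 - 1 / (2 * D)) ^ 2) two_pos
  have hd0 : d ≠ 0 := by rintro rfl; simp at hd; exact hD0 hd
  obtain ⟨g, hgx, hgy⟩ := exists_isom_pair (PP m 0 0) (PP m d 0) x y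
    (by rw [phi_PP, hxy, hd]; ring) (by rw [phi_PP]; simpa using hd0)
  let z := g.app (PP m (d * (1 - 1 / (2 * D))) (d / w * β))
  have hxz : phi (m + 1) x z = D := by
    rw [← hgx, g.phi_app, phi_PP, ← hw]
    field_simp
    field_simp at hβ
    rw [hd] at hβ ⊢
    field_simp at hβ ⊢
    linear_combination hβ
  have hyz : phi (m + 1) y z = 1 := by
    rw [← hgy, g.phi_app, phi_PP, ← hw]
    field_simp
    field_simp at hβ
    rw [hd] at hβ ⊢
    field_simp at hβ ⊢
    linear_combination hβ
  have h2 := hf1 _ _ hyz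
  rw [← h1] at h2
  rcases h x z hxz with h3 | h3
  · rw [h3] at h2; simp [phi] at h2
  · exact hD1 (h3.symm.trans h2)

theorem pres_double (hm : 1 ≤ m) (hs : s ^ 2 = 1 / 2) (hw : w ^ 2 = m) (hr : r ≠ 0) {θ : ℂ}
    (hθ : Complex.sin θ ≠ 0) {f : (Fin (m + 1) → ℂ) → (Fin (m + 1) → ℂ)} (hf1 : Pres f 1)
    (hfB : Pres f (r ^ 2 + 1 / 2 - 1 / (2 * m)))
    (hfC : Pres f (2 * r ^ 2 * (1 - Complex.cos θ)))
    (hD0 : 2 * r ^ 2 * (1 - Complex.cos (2 * θ)) ≠ 0)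
    (hD1 : 2 * r ^ 2 * (1 - Complex.cos (2 * θ)) ≠ 1) :
    Pres f (2 * r ^ 2 * (1 - Complex.cos (2 * θ))) := by
  apply spindle hm hw hf1 hD0 hD1
  intro x y hxy
  have hX : phi (m + 1) (XX m s w r 0) (XX m s w r (θ + θ)) =
      2 * r ^ 2 * (1 - Complex.cos (2 * θ)) := by
    rw [phi_XX hm hw, ← Complex.cos_neg]; congr 3; ring
  obtain ⟨G, hGx, hGy⟩ := exists_isom_pair (XX m s w r 0) (XX m s w r (θ + θ)) x y
    (by rw [hX, hxy]) (by rw [hX]; exact hD0)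
  obtain ⟨g, h0, h1, h2⟩ := exists_frame hm hs hw hr hθ (hf1.comp_app G) (hfB.comp_app G)
    (hfC.comp_app G)
  have := next_pt hm hs hw hr (hfB.comp_app G) (hfC.comp_app G) g h2 θ h1
  simp only [hGx, hGy] at h0 h1 this
  rcases this with h | h
  · right
    rw [h, ← h0, g.phi_app, hX]
  · left
    rw [h, sub_self, h0]

theorem pres_mul (hm : 1 ≤ m) (hs : s ^ 2 = 1 / 2) (hw : w ^ 2 = m) (hr : r ≠ 0) {θ : ℂ}
    (hθ : Complex.sin θ ≠ 0) {f : (Fin (m + 1) → ℂ) → (Fin (m + 1) → ℂ)} (hf1 : Pres f 1)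
    (hfB : Pres f (r ^ 2 + 1 / 2 - 1 / (2 * m)))
    (hfC : Pres f (2 * r ^ 2 * (1 - Complex.cos θ)))
    (hD0 : 2 * r ^ 2 * (1 - Complex.cos (2 * θ)) ≠ 0)
    (hD1 : 2 * r ^ 2 * (1 - Complex.cos (2 * θ)) ≠ 1) (k : ℕ)
    (hk : 2 * r ^ 2 * (1 - Complex.cos (k * θ)) ≠ 0) :
    Pres f (2 * r ^ 2 * (1 - Complex.cos (k * θ))) := by
  intro x y hxy
  have hX : phi (m + 1) (XX m s w r 0) (XX m s w r (k * θ)) =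
      2 * r ^ 2 * (1 - Complex.cos (k * θ)) := by
    rw [phi_XX hm hw, ← Complex.cos_neg]; congr 3; ring
  obtain ⟨G, hGx, hGy⟩ := exists_isom_pair (XX m s w r 0) (XX m s w r (k * θ)) x y
    (by rw [hX, hxy]) (by rw [hX]; exact hk)
  have hf1' := hf1.comp_app G
  have hfB' := hfB.comp_app G
  have hfC' := hfC.comp_app G
  have hfD' := pres_double hm hs hw hr hθ hf1' hfB' hfC' hD0 hD1
  obtain ⟨g, h0, h1, h2⟩ := exists_frame hm hs hw hr hθ hf1' hfB' hfC'
  have key : ∀ j : ℕ, f (G.app (XX m s w r (j * θ))) = g.app (XX m s w r (j * θ)) ∧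
      f (G.app (XX m s w r ((j + 1 : ℕ) * θ))) = g.app (XX m s w r ((j + 1 : ℕ) * θ)) := by
    intro j
    induction j with
    | zero => simp [h0, h1]
    | succ j ih =>
      refine ⟨ih.2, ?_⟩
      have e1 : ((j + 1 + 1 : ℕ) : ℂ) * θ = ((j + 1 : ℕ) : ℂ) * θ + θ := by push_cast; ring
      have e2 : ((j : ℕ) : ℂ) * θ = ((j + 1 : ℕ) : ℂ) * θ - θ := by push_cast; ring
      rw [e1]
      rcases next_pt hm hs hw hr hfB' hfC' g h2 _ ih.2.symm with h | h
      · exact h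
      · exfalso
        have hd := hfD' (XX m s w r (((j + 1 : ℕ) : ℂ) * θ + θ)) (XX m s w r (j * θ))
          (by rw [phi_XX hm hw]; congr 3; rw [e2]; ring)
        simp only at hd h
        rw [h, ← e2, ih.1] at hd
        apply hD0
        rw [← hd]; simp [phi]
  have h3 := (key k).1
  have h4 := (key 0).1
  simp only [Nat.cast_zero, zero_mul, hGx] at h4
  rw [hGy] at h3
  rw [h3, h4, g.phi_app, hX]

end circle

theorem continuous_phi (n : ℕ) {α : Type*} [TopologicalSpace α] {u v : α → Fin n → ℂ}
    (hu : Continuous u) (hv : Continuous v) : Continuous (fun a => phi n (u a) (v a)) := by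
  unfold phi
  fun_prop

theorem phi_smul_line {n : ℕ} (x v : Fin n → ℂ) (c : ℂ) :
    phi n x (x + c • v) = c ^ 2 * (v ⬝ᵥ v) := by
  simp only [phi, dotProduct, Finset.mul_sum]
  exact Finset.sum_congr rfl fun i _ => by
    simp only [Pi.add_apply, Pi.smul_apply, smul_eq_mul]; ring

theorem pres_interval {n : ℕ} {f : (Fin n → ℂ) → (Fin n → ℂ)} (hcont : Continuous f)
    {ρ θ : ℝ} (hρ : 0 < ρ) (hirr : Irrational (θ / (2 * Real.pi)))
    (hk : ∀ k : ℕ, 2 * ρ * (1 - Real.cos (k * θ)) ≠ 0 →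
      Pres f ((2 * ρ * (1 - Real.cos (k * θ)) : ℝ) : ℂ))
    {t : ℝ} (ht : 0 < t) (ht' : t ≤ 4 * ρ) : Pres f (t : ℂ) := by
  intro x y hxy
  obtain ⟨v, rfl⟩ : ∃ v, y = x + v := ⟨y - x, by abel⟩
  have hv : v ⬝ᵥ v = (t : ℂ) := by
    have := phi_smul_line x v 1
    rw [one_smul, hxy] at this
    rw [this]; ring
  have hphi : ∀ τ : ℝ, 0 ≤ τ → phi n x (x + ((Real.sqrt (τ / t) : ℝ) : ℂ) • v) = (τ : ℂ) := by
    intro τ hτ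
    rw [phi_smul_line, hv, ← Complex.ofReal_pow, Real.sq_sqrt (by positivity),
      ← Complex.ofReal_mul, div_mul_cancel₀ _ ht.ne']
  let K : Set ℝ := {ψ | phi n (f x) (f (x + ((Real.sqrt (2 * ρ * (1 - Real.cos ψ) / t) : ℝ) : ℂ) • v))
    = ((2 * ρ * (1 - Real.cos ψ) : ℝ) : ℂ)}
  have hK : IsClosed K := by
    apply isClosed_eq
    · apply continuous_phi
      · exact continuous_const
      · apply hcont.comp
        fun_prop
    · fun_prop
  have hdense := dense_addSubgroupClosure_pair_iff.mpr hirr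
  have hsub : (AddSubgroup.closure {θ, 2 * Real.pi} : Set ℝ) ⊆ K := by
    intro ψ hψ
    obtain ⟨a, b, rfl⟩ := AddSubgroup.mem_closure_pair.mp hψ
    have hcos : Real.cos (a • θ + b • (2 * Real.pi)) = Real.cos ((a.natAbs : ℕ) * θ) := by
      rw [zsmul_eq_mul, zsmul_eq_mul, Real.cos_add_int_mul_two_pi]
      rcases Int.natAbs_eq a with h | h
      · conv_lhs => rw [h]
        simp
      · conv_lhs => rw [h]
        simp
    simp only [K, Set.mem_ofPred_eq]
    rw [hcos]
    by_cases h0 : 2 * ρ * (1 - Real.cos ((a.natAbs : ℕ) * θ)) = 0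
    · rw [h0]; simp [phi]
    · apply hk _ h0
      apply hphi
      have := Real.cos_le_one ((a.natAbs : ℕ) * θ)
      have : 0 ≤ 1 - Real.cos ((a.natAbs : ℕ) * θ) := by linarith
      positivity
  have hall : Real.arccos (1 - t / (2 * ρ)) ∈ K := by
    have := hdense.mono hsub
    rw [← hK.closure_eq, this.closure_eq]; trivial
  simp only [K, Set.mem_ofPred_eq] at hall
  rw [Real.cos_arccos] at hall
  · have e : 2 * ρ * (1 - (1 - t / (2 * ρ))) = t := by field_simp; ring
    rw [e, div_self ht.ne'] at hall
    simpa using hall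
  · have : t / (2 * ρ) ≤ 2 := by rw [div_le_iff₀ (by positivity)]; linarith
    linarith
  · have : 0 ≤ t / (2 * ρ) := by positivity
    linarith

theorem base_aux {m : ℕ} (hm : 1 ≤ m) {f : (Fin (m + 1) → ℂ) → (Fin (m + 1) → ℂ)}
    (hcont : Continuous f) (hf1 : Pres f 1) {ρ : ℝ} {c : ℚ} (hρ : 0 < ρ)
    (hc1 : (-1 : ℝ) < c) (hc2 : (c : ℝ) < 1)
    (hniven : (c : ℝ) ∉ ({-1, -1 / 2, 0, 1 / 2, 1} : Set ℝ))
    (hB : Pres f ((ρ + 1 / 2 - 1 / (2 * m) : ℝ) : ℂ))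
    (hC : Pres f ((2 * ρ * (1 - c) : ℝ) : ℂ))
    (hD : 4 * ρ * (1 - (c : ℝ) ^ 2) ≠ 1) {t : ℝ} (ht : 0 < t) (ht' : t ≤ 4 * ρ) :
    Pres f (t : ℂ) := by
  let θ : ℝ := Real.arccos c
  have hθ : Real.cos θ = c := Real.cos_arccos hc1.le hc2.le
  have hc3 : 0 < 1 - (c : ℝ) ^ 2 := by nlinarith
  have hsin : Real.sin θ ≠ 0 := by
    intro h
    have := Real.sin_sq_add_cos_sq θ
    rw [h, hθ] at this
    nlinarith
  have hirr : Irrational (θ / (2 * Real.pi)) := by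
    rintro ⟨q, hq⟩
    apply hniven
    rw [← hθ]
    refine niven ⟨2 * q, ?_⟩ ⟨c, hθ⟩
    have := Real.pi_pos
    push_cast
    rw [hq]; field_simp
  obtain ⟨s, hs⟩ := IsAlgClosed.exists_pow_nat_eq (1 / 2 : ℂ) two_pos
  obtain ⟨w, hw⟩ := IsAlgClosed.exists_pow_nat_eq (m : ℂ) two_pos
  have hr2 : ((Real.sqrt ρ : ℝ) : ℂ) ^ 2 = (ρ : ℂ) := by
    rw [← Complex.ofReal_pow, Real.sq_sqrt hρ.le]
  have hr0 : ((Real.sqrt ρ : ℝ) : ℂ) ≠ 0 := by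
    exact_mod_cast (Real.sqrt_pos.mpr hρ).ne'
  have hcosm : ∀ k : ℕ, (2 * (ρ : ℂ) * (1 - Complex.cos (k * θ))) =
      ((2 * ρ * (1 - Real.cos (k * θ)) : ℝ) : ℂ) := by
    intro k; push_cast; rfl
  have hD' : (2 * (ρ : ℂ) * (1 - Complex.cos (2 * θ))) = ((4 * ρ * (1 - c ^ 2) : ℝ) : ℂ) := by
    have := hcosm 2
    push_cast at this
    rw [Complex.cos_two_mul, ← Complex.ofReal_cos, hθ]
    push_cast; ring
  refine pres_interval hcont hρ hirr ?_ ht ht'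
  intro k hk
  have := pres_mul (θ := (θ : ℂ)) hm hs hw hr0 (by rw [← Complex.ofReal_sin]; exact_mod_cast hsin)
    hf1 (f := f) ?_ ?_ ?_ ?_ k ?_
  · rwa [hr2, hcosm] at this
  · rw [hr2]; push_cast at hB; exact hB
  · rw [hr2, ← Complex.ofReal_cos, hθ]; push_cast at hC ⊢; exact hC
  · rw [hr2, hD']
    have : 4 * ρ * (1 - (c : ℝ) ^ 2) ≠ 0 := by positivity
    exact_mod_cast this
  · rw [hr2, hD']; exact_mod_cast hD
  · rw [hr2, hcosm]; exact_mod_cast hk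

theorem pres_three {f : (Fin (1 + 1) → ℂ) → (Fin (1 + 1) → ℂ)} (hf1 : Pres f 1) : Pres f 3 := by
  obtain ⟨s, hs⟩ := IsAlgClosed.exists_pow_nat_eq (1 / 2 : ℂ) two_pos
  have hcos : Complex.cos ((Real.pi / 3 : ℝ) : ℂ) = 1 / 2 := by
    rw [← Complex.ofReal_cos, Real.cos_pi_div_three]; push_cast; rfl
  have hD : 2 * (1 : ℂ) ^ 2 * (1 - Complex.cos (2 * ((Real.pi / 3 : ℝ) : ℂ))) = 3 := by
    rw [Complex.cos_two_mul, hcos]; norm_num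
  have := pres_double (m := 1) (s := s) (w := 1) (r := 1) (θ := ((Real.pi / 3 : ℝ) : ℂ)) le_rfl hs
    (by norm_num) one_ne_zero ?_ hf1 ?_ ?_ ?_ ?_
  · rwa [hD] at this
  · rw [← Complex.ofReal_sin, Real.sin_pi_div_three]
    have : Real.sqrt 3 / 2 ≠ 0 := by positivity
    exact_mod_cast this
  · convert hf1 using 1; norm_num
  · rw [hcos]; convert hf1 using 1; norm_num
  · rw [hD]; norm_num
  · rw [hD]; norm_num

theorem base_interval {m : ℕ} (hm : 1 ≤ m) : ∃ l : ℝ, 1 < l ∧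
    ∀ f : (Fin (m + 1) → ℂ) → (Fin (m + 1) → ℂ), Continuous f → Pres f 1 →
      ∀ t : ℝ, 0 < t → t ≤ l → Pres f (t : ℂ) := by
  rcases Nat.lt_or_ge 1 m with h | h
  · have hm2 : (2 : ℝ) ≤ m := by exact_mod_cast h
    have hm0 : (0 : ℝ) < m := by linarith
    refine ⟨4 * ((m + 1) / (2 * m)), ?_, ?_⟩
    · rw [← sub_pos]
      have : 4 * (((m : ℝ) + 1) / (2 * m)) - 1 = (m + 2) / m := by field_simp; ring
      rw [this]; positivity
    · intro f hcont hf1 t ht ht'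
      have e0 : ((1 / (m + 1) : ℚ) : ℝ) = 1 / (m + 1) := by push_cast; rfl
      have p1 : (0 : ℝ) < 1 / (m + 1) := by positivity
      have p2 : (1 : ℝ) / (m + 1) < 1 / 2 := by
        rw [div_lt_div_iff₀ (by positivity) (by positivity)]; linarith
      refine base_aux hm hcont hf1 (ρ := (m + 1) / (2 * m)) (c := 1 / (m + 1)) (by positivity)
        ?_ ?_ ?_ ?_ ?_ ?_ ht ht' <;> try rw [e0]
      · linarith
      · linarith
      · simp only [Set.mem_insert_iff, Set.mem_singleton_iff, not_or]
        refine ⟨?_, ?_, ?_, ?_, ?_⟩ <;> intro h <;> linarith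
      · convert hf1 using 1
        have : ((m : ℝ) + 1) / (2 * m) + 1 / 2 - 1 / (2 * m) = 1 := by field_simp; ring
        exact_mod_cast this
      · convert hf1 using 1
        have : 2 * (((m : ℝ) + 1) / (2 * m)) * (1 - 1 / (m + 1)) = 1 := by field_simp; ring
        exact_mod_cast this
      · have : 4 * (((m : ℝ) + 1) / (2 * m)) * (1 - (1 / (m + 1)) ^ 2) - 1 = (m + 3) / (m + 1) := by
          field_simp; ring
        have h3 : (0 : ℝ) < (m + 3) / (m + 1) := by positivity
        linarith
  · obtain rfl : m = 1 := by omega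
    refine ⟨12, by norm_num, ?_⟩
    intro f hcont hf1 t ht ht'
    refine base_aux hm hcont hf1 (ρ := 3) (c := 5 / 6) (by positivity)
        ?_ ?_ ?_ ?_ ?_ ?_ ht (by linarith)
    · norm_num
    · norm_num
    · norm_num
    · convert pres_three hf1 using 1; norm_num
    · convert hf1 using 1; norm_num
    · norm_num

theorem pres_all {m : ℕ} (hm : 1 ≤ m) {f : (Fin (m + 1) → ℂ) → (Fin (m + 1) → ℂ)}
    (hcont : Continuous f) (hf1 : Pres f 1) {t : ℝ} (ht : 0 < t) : Pres f (t : ℂ) := by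
  obtain ⟨l, hl, H⟩ := base_interval hm
  have key : ∀ j : ℕ, ∀ t : ℝ, 0 < t → t ≤ l ^ (j + 1) → Pres f (t : ℂ) := by
    intro j
    induction j with
    | zero => intro t ht ht'; exact H f hcont hf1 t ht (by simpa using ht')
    | succ j ih =>
      intro t ht ht'
      have hμ : 0 < t / l := by positivity
      have h1 := ih (t / l) hμ (by rw [div_le_iff₀ (by positivity)]; rwa [pow_succ] at ht')
      let a : ℂ := ((Real.sqrt (t / l) : ℝ) : ℂ)
      have ha : a ^ 2 = ((t / l : ℝ) : ℂ) := by
        simp only [a]; rw [← Complex.ofReal_pow, Real.sq_sqrt hμ.le]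
      have ha0 : a ≠ 0 := by
        simp only [a]; exact_mod_cast (Real.sqrt_pos.mpr hμ).ne'
      have hsm : ∀ (b : ℂ) X Y, phi (m + 1) (b • X) (b • Y) = b ^ 2 * phi (m + 1) X Y := by
        intro b X Y
        simp only [phi, Finset.mul_sum]
        exact Finset.sum_congr rfl fun i _ => by
          simp only [Pi.smul_apply, smul_eq_mul]; ring
      have h2 := H (fun x => a⁻¹ • f (a • x)) (by fun_prop) ?_ l (by positivity) le_rfl
      · intro X Y hXY
        have hl0 : (l : ℂ) ≠ 0 := by exact_mod_cast (by positivity : l ≠ 0)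
        have h3 := h2 (a⁻¹ • X) (a⁻¹ • Y) ?_
        · simp only [smul_smul, mul_inv_cancel₀ ha0, one_smul, hsm] at h3
          rw [inv_pow, inv_mul_eq_iff_eq_mul₀ (pow_ne_zero 2 ha0), ha] at h3
          rw [h3]; push_cast; field_simp
        · rw [hsm, hXY, inv_pow, ha]
          have ht0 : (t : ℂ) ≠ 0 := by exact_mod_cast ht.ne'
          push_cast; field_simp
      · intro X Y hXY
        simp only [hsm]
        rw [h1 (a • X) (a • Y) (by rw [hsm, hXY, ha, mul_one]), inv_pow, ← ha,
          inv_mul_cancel₀ (pow_ne_zero 2 ha0)]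
  obtain ⟨j, hj⟩ := pow_unbounded_of_one_lt t hl
  exact key j t ht (hj.le.trans (pow_le_pow_right₀ hl.le (by omega)))

theorem phi_single {n : ℕ} (Z : Fin n → ℂ) (i : Fin n) :
    phi n Z (Pi.single i 1) = phi n Z 0 - 2 * Z i + 1 := by
  have h := polar n 0 Z (Pi.single i 1)
  have h2 : phi n (Pi.single i 1) 0 = 1 := by
    rw [phi_eq]; simp
  rw [h2, sub_zero, sub_zero, dotProduct_single_one] at h
  linear_combination 2 * h

theorem exists_norm {n : ℕ} {f : (Fin n → ℂ) → (Fin n → ℂ)}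
    (h1 : Pres f 1) (h2 : Pres f 2) :
    ∃ g : Isom n, g.app 0 = f 0 ∧ ∀ i, g.app (Pi.single i 1) = f (Pi.single i 1) := by
  have e1 : ∀ i : Fin n, phi n (Pi.single i 1) 0 = 1 := by
    intro i; rw [phi_eq]; simp
  have e2 : ∀ i j : Fin n, i ≠ j → phi n (Pi.single i 1) (Pi.single j 1) = 2 := by
    intro i j hij; rw [phi_single, e1, Pi.single_eq_of_ne hij.symm]; norm_num
  refine exists_isom_frame 0 (f 0) (fun i => Pi.single i 1) (fun i => f (Pi.single i 1)) ?_ ?_ ?_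
  · intro v hv
    ext i
    have := hv i
    simpa using this
  · intro i; rw [e1, h1 _ _ (e1 i)]
  · intro i j
    by_cases hij : i = j
    · subst hij; simp [phi]
    · rw [e2 i j hij, h2 _ _ (e2 i j hij)]

theorem phi_real {n : ℕ} (x y : Fin n → ℝ) :
    phi n (fun i => (x i : ℂ)) (fun i => (y i : ℂ)) = ((∑ i, (x i - y i) ^ 2 : ℝ) : ℂ) := by
  simp [phi]

theorem pres_real {n : ℕ} {f : (Fin n → ℂ) → (Fin n → ℂ)} (h : ∀ t : ℝ, 0 < t → Pres f (t : ℂ))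
    (x y : Fin n → ℝ) : phi n (f fun i => (x i : ℂ)) (f fun i => (y i : ℂ)) =
      phi n (fun i => (x i : ℂ)) (fun i => (y i : ℂ)) := by
  by_cases hxy : x = y
  · subst hxy; simp [phi]
  · rw [phi_real]
    apply h _ _ _ _ (phi_real x y)
    obtain ⟨i, hi⟩ := Function.ne_iff.mp hxy
    exact Finset.sum_pos' (fun i _ => sq_nonneg _)
      ⟨i, Finset.mem_univ i, by have := sub_ne_zero.mpr hi; positivity⟩

theorem fix_real {n : ℕ} {f : (Fin n → ℂ) → (Fin n → ℂ)} (h : ∀ t : ℝ, 0 < t → Pres f (t : ℂ))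
    (h0 : f 0 = 0) (h1 : ∀ i, f (Pi.single i 1) = Pi.single i 1) (x : Fin n → ℝ) :
    f (fun i => (x i : ℂ)) = fun i => (x i : ℂ) := by
  have a0 := pres_real h x 0
  have e0 : (fun i => (((0 : Fin n → ℝ) i : ℝ) : ℂ)) = 0 := by ext; simp
  rw [e0, h0] at a0
  ext i
  have ai := pres_real h x (Pi.single i 1)
  have ei : (fun j => (((Pi.single i 1 : Fin n → ℝ) j : ℝ) : ℂ)) = Pi.single i 1 := by
    ext j
    by_cases hj : j = i
    · subst hj; simp
    · simp [hj]
  rw [ei, h1, phi_single, phi_single, a0] at ai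
  linear_combination -ai / 2

/-- The vector a + i b. -/
noncomputable def cx {n : ℕ} (a b : Fin n → ℝ) : Fin n → ℂ := fun i => a i + b i * Complex.I

theorem phi_cx {n : ℕ} (a b s : Fin n → ℝ) (hs : ∑ i, s i * b i = 0) :
    phi n (cx a b) (fun i => ((a i + s i : ℝ) : ℂ)) = ((∑ i, s i ^ 2 - ∑ i, b i ^ 2 : ℝ) : ℂ) := by
  have : ∀ i, (cx a b i - ((a i + s i : ℝ) : ℂ)) ^ 2 =
      (s i : ℂ) ^ 2 - (b i : ℂ) ^ 2 - 2 * Complex.I * ((s i : ℂ) * b i) := by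
    intro i
    simp only [cx]; push_cast
    linear_combination (b i : ℂ) ^ 2 * Complex.I_sq
  have hs' : ∑ i, (s i : ℂ) * b i = 0 := by exact_mod_cast hs
  simp only [phi, this, Finset.sum_sub_distrib, ← Finset.mul_sum, hs']
  push_cast; ring

theorem cx_or {n : ℕ} (hn : 2 ≤ n) {f : (Fin n → ℂ) → (Fin n → ℂ)}
    (h : ∀ t : ℝ, 0 < t → Pres f (t : ℂ))
    (hre : ∀ x : Fin n → ℝ, f (fun i => (x i : ℂ)) = fun i => (x i : ℂ)) (a b : Fin n → ℝ) :
    f (cx a b) = cx a b ∨ f (cx a b) = cx a (-b) := by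
  by_cases hb : b = 0
  · left
    have : cx a b = fun i => (a i : ℂ) := by ext i; simp [cx, hb]
    rw [this, hre]
  obtain ⟨i, hi⟩ := Function.ne_iff.mp hb
  simp only [Pi.zero_apply] at hi
  have hN : 0 < ∑ i, b i ^ 2 := Finset.sum_pos' (fun i _ => sq_nonneg _)
      ⟨i, Finset.mem_univ i, by positivity⟩
  set N := ∑ i, b i ^ 2 with hNdef
  let z : Fin n → ℂ := fun i => f (cx a b) i - a i
  -- basic identity
  have base : ∀ s : Fin n → ℝ, ∑ i, s i * b i = 0 → N < ∑ i, s i ^ 2 →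
      ∑ i, z i ^ 2 - 2 * ∑ i, z i * s i = -(N : ℂ) := by
    intro s hs hlt
    have h1 := h _ (sub_pos.mpr hlt) _ _ (phi_cx a b s hs)
    rw [hre] at h1
    have h2 : ∀ i, (f (cx a b) i - ((a i + s i : ℝ) : ℂ)) ^ 2 =
        z i ^ 2 - 2 * (z i * s i) + (s i : ℂ) ^ 2 := by
      intro i; simp only [z]; push_cast; ring
    simp only [phi, h2, Finset.sum_add_distrib, Finset.sum_sub_distrib, ← Finset.mul_sum] at h1
    push_cast at h1
    linear_combination h1
  have both : ∀ s : Fin n → ℝ, ∑ i, s i * b i = 0 → s ≠ 0 →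
      ∑ i, z i * s i = 0 ∧ ∑ i, z i ^ 2 = -(N : ℂ) := by
    intro s hs hs0
    obtain ⟨j, hj⟩ := Function.ne_iff.mp hs0
    simp only [Pi.zero_apply] at hj
    have hS : 0 < ∑ i, s i ^ 2 := Finset.sum_pos' (fun i _ => sq_nonneg _)
      ⟨j, Finset.mem_univ j, by positivity⟩
    have hsc : ∀ c : ℝ, (N + 1) / (∑ i, s i ^ 2) ≤ c ^ 2 →
        ∑ i, z i ^ 2 - 2 * (c * ∑ i, z i * s i) = -(N : ℂ) := by
      intro c hc
      have := base (fun i => c * s i) ?_ ?_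
      · rw [← this, Finset.mul_sum]
        congr 2
        exact Finset.sum_congr rfl fun i _ => by push_cast; ring
      · simp only [mul_assoc]; rw [← Finset.mul_sum, hs, mul_zero]
      · simp only [mul_pow]; rw [← Finset.mul_sum]
        rw [div_le_iff₀ hS] at hc
        linarith
    let c := Real.sqrt ((N + 1) / (∑ i, s i ^ 2))
    have hc2 : c ^ 2 = (N + 1) / (∑ i, s i ^ 2) := Real.sq_sqrt (by positivity)
    have hc0 : c ≠ 0 := by
      intro h0
      have : 0 < (N + 1) / (∑ i, s i ^ 2) := by positivity
      rw [← hc2, h0] at this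
      norm_num at this
    have k1 := hsc c hc2.ge
    have k2 := hsc (-c) (by rw [neg_sq]; exact hc2.ge)
    push_cast at k2
    have hc0' : (c : ℂ) ≠ 0 := by exact_mod_cast hc0
    refine ⟨?_, by linear_combination (k1 + k2) / 2⟩
    have : (c : ℂ) * ∑ i, z i * s i = 0 := by linear_combination (k2 - k1) / 4
    simpa [hc0'] using this
  -- the swap vectors
  have swap : ∀ p q : Fin n, p ≠ q →
      ∑ k, (Pi.single p (b q) - Pi.single q (b p) : Fin n → ℝ) k * b k = 0 := by
    intro p q _
    simp only [Pi.sub_apply, sub_mul, Finset.sum_sub_distrib, Pi.single_apply, ite_mul, zero_mul,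
      Finset.sum_ite_eq', Finset.mem_univ, if_true]
    ring
  have swapz : ∀ p q : Fin n, p ≠ q →
      ∑ k, z k * ((Pi.single p (b q) - Pi.single q (b p) : Fin n → ℝ) k : ℂ) =
        z p * b q - z q * b p := by
    intro p q _
    simp only [Pi.sub_apply, Complex.ofReal_sub, mul_sub, Finset.sum_sub_distrib, Pi.single_apply,
      apply_ite Complex.ofReal, Complex.ofReal_zero, mul_ite, mul_zero,
      Finset.sum_ite_eq', Finset.mem_univ, if_true]
  have cross : ∀ q : Fin n, z q * b i = z i * b q := by
    intro q
    by_cases hq : q = i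
    · subst hq; rfl
    · have hne : (Pi.single q (b i) - Pi.single i (b q) : Fin n → ℝ) ≠ 0 := by
        intro h0
        have := congrFun h0 q
        simp [hq] at this
        exact hi this
      have := (both _ (swap q i hq) hne).1
      rw [swapz q i hq] at this
      linear_combination this
  have hqz : ∑ i, z i ^ 2 = -(N : ℂ) := by
    haveI : Nontrivial (Fin n) := Fin.nontrivial_iff_two_le.mpr hn
    obtain ⟨q, hq⟩ := exists_ne i
    have hne : (Pi.single q (b i) - Pi.single i (b q) : Fin n → ℝ) ≠ 0 := by
        intro h0
        have := congrFun h0 q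
        simp [hq] at this
        exact hi this
    exact (both _ (swap q i hq) hne).2
  have hbi : (b i : ℂ) ≠ 0 := by exact_mod_cast hi
  have hz : ∀ q, z q = z i / b i * b q := by
    intro q; have := cross q; field_simp; linear_combination this
  have hl : (z i / b i) ^ 2 = Complex.I ^ 2 := by
    have e : ∑ q, z q ^ 2 = (z i / b i) ^ 2 * (N : ℂ) := by
      rw [hNdef]; push_cast; rw [Finset.mul_sum]
      exact Finset.sum_congr rfl fun q _ => by rw [hz q]; ring
    have hN' : (N : ℂ) ≠ 0 := by exact_mod_cast hN.ne'
    rw [Complex.I_sq]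
    exact mul_right_cancel₀ hN' (by rw [← e, hqz]; ring)
  have hfz : ∀ q, f (cx a b) q = a q + z q := by intro q; simp only [z]; ring
  rcases sq_eq_sq_iff_eq_or_eq_neg.mp hl with e | e
  · left
    ext q
    rw [hfz, hz, e, cx]; ring
  · right
    ext q
    rw [hfz, hz, e, cx]; simp only [Pi.neg_apply]; push_cast; ring

theorem cx_alt {n : ℕ} (hn : 2 ≤ n) {f : (Fin n → ℂ) → (Fin n → ℂ)} (hcont : Continuous f)
    (h : ∀ a b : Fin n → ℝ, f (cx a b) = cx a b ∨ f (cx a b) = cx a (-b)) :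
    (∀ a b, f (cx a b) = cx a b) ∨ (∀ a b, f (cx a b) = cx a (-b)) := by
  have hconn : IsPreconnected ((Set.univ : Set (Fin n → ℝ)) ×ˢ ({0}ᶜ : Set (Fin n → ℝ))) := by
    apply isPreconnected_univ.prod
    apply (isConnected_compl_singleton_of_one_lt_rank _ 0).isPreconnected
    rw [rank_fin_fun]
    exact_mod_cast hn
  have hc1 : Continuous fun p : (Fin n → ℝ) × (Fin n → ℝ) => cx p.1 p.2 := by
    unfold cx; fun_prop
  have hc2 : Continuous fun p : (Fin n → ℝ) × (Fin n → ℝ) => cx p.1 (-p.2) := by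
    unfold cx; fun_prop
  have hA := isClosed_eq (hcont.comp hc1) hc1
  have hB := isClosed_eq (hcont.comp hc1) hc2
  rw [isPreconnected_closed_iff] at hconn
  have key := hconn _ _ hA hB (fun p _ => h p.1 p.2)
  by_contra hcon
  push Not at hcon
  obtain ⟨⟨a, b, h1⟩, ⟨a', b', h2⟩⟩ := hcon
  have z1 : ∀ a : Fin n → ℝ, cx a (-0) = cx a 0 := by intro a; simp
  have hb : b ≠ 0 := by
    rintro rfl
    rcases h a 0 with h' | h'
    · exact h1 h'
    · rw [z1] at h'; exact h1 h'
  have hb' : b' ≠ 0 := by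
    rintro rfl
    rcases h a' 0 with h' | h'
    · rw [z1] at h2; exact h2 h'
    · exact h2 h'
  obtain ⟨⟨u, v⟩, hv, e1, e2⟩ := key ⟨(a', b'), ⟨trivial, hb'⟩, (h a' b').resolve_right h2⟩
    ⟨(a, b), ⟨trivial, hb⟩, (h a b).resolve_left h1⟩
  apply hv.2
  have e3 : cx u v = cx u (-v) := e1.symm.trans e2
  ext i
  have e4 := congrFun e3 i
  simp only [cx, Pi.neg_apply] at e4
  have e5 := congrArg Complex.im e4
  simp at e5
  simp; linarith

/-- If n ≥ 2 and a continuous map f : ℂⁿ → ℂⁿ preserves unit distance, then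
f = I ∘ (ρ,...,ρ) for some affine map I with orthogonal linear part and
ρ ∈ {id, complex conjugation}. -/
theorem stmt_0 (n : ℕ) (hn : 2 ≤ n) (f : (Fin n → ℂ) → (Fin n → ℂ))
    (hcont : Continuous f)
    (hf : ∀ X Y : Fin n → ℂ, phi n X Y = 1 ^ 2 → phi n (f X) (f Y) = 1 ^ 2) :
    ∃ (I : (Fin n → ℂ) →ᵃ[ℂ] (Fin n → ℂ)) (ρ : ℂ → ℂ),
      (∀ X Y : Fin n → ℂ, phi n (I X) (I Y) = phi n X Y) ∧
      (ρ = id ∨ ρ = fun z => (starRingEnd ℂ) z) ∧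
      (∀ X : Fin n → ℂ, f X = I (fun i => ρ (X i))) := by
  obtain ⟨m, rfl⟩ : ∃ m, n = m + 1 := ⟨n - 1, by omega⟩
  have hf1 : Pres f 1 := fun X Y h => by
    have := hf X Y (by rw [h]; norm_num)
    rw [this]; norm_num
  have hall : ∀ t : ℝ, 0 < t → Pres f (t : ℂ) := fun t ht => pres_all (by omega) hcont hf1 ht
  obtain ⟨g, hg0, hg1⟩ := exists_norm hf1 (by simpa using hall 2 (by norm_num))
  have hall' : ∀ t : ℝ, 0 < t → Pres (fun x => g.inv (f x)) (t : ℂ) :=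
    fun t ht => (hall t ht).inv_comp g
  have hre := fix_real hall' (by rw [← hg0, g.inv_app])
    (fun i => by rw [← hg1, g.inv_app])
  have hcont' : Continuous (fun x => g.inv (f x)) := g.continuous_inv.comp hcont
  have hcx : ∀ X : Fin (m + 1) → ℂ, X = cx (fun i => (X i).re) (fun i => (X i).im) := by
    intro X; ext i; simp [cx]
  let I : (Fin (m + 1) → ℂ) →ᵃ[ℂ] (Fin (m + 1) → ℂ) :=
    (Matrix.mulVecLin g.L).toAffineMap + AffineMap.const ℂ _ g.t
  have hI : ∀ X, I X = g.app X := by intro X; simp [I, Isom.app]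
  have hIphi : ∀ X Y, phi (m + 1) (I X) (I Y) = phi (m + 1) X Y := by
    intro X Y; rw [hI, hI, g.phi_app]
  rcases cx_alt hn hcont' (cx_or hn hall' hre) with h | h
  · refine ⟨I, id, hIphi, Or.inl rfl, ?_⟩
    intro X
    rw [hI]
    have := h (fun i => (X i).re) (fun i => (X i).im)
    rw [← hcx] at this
    simp only [id]
    rw [← g.app_inv (f X), this]
  · refine ⟨I, fun z => (starRingEnd ℂ) z, hIphi, Or.inr rfl, ?_⟩
    intro X
    rw [hI]
    have := h (fun i => (X i).re) (fun i => (X i).im)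
    rw [← hcx] at this
    rw [← g.app_inv (f X), this]
    congr 1
    ext i
    apply Complex.ext <;> simp [cx]
end

section
/- If n ≥ 2 and a continuous map f : ℂⁿ → ℂⁿ preserves unit distance, then f preserves all positive distances, i.e., for every real d > 0 and all X, Y ∈ ℂⁿ with φ_n(X,Y) = d² one has φ_n(f(X), f(Y)) = d². -/
open Matrix

namespace BQ

/-- The map `f` preserves the squared distance `s`. -/
def Pres (n : ℕ) (f : (Fin n → ℂ) → (Fin n → ℂ)) (s : ℂ) : Prop :=
  ∀ X Y : Fin n → ℂ, (X - Y) ⬝ᵥ (X - Y) = s → (f X - f Y) ⬝ᵥ (f X - f Y) = s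

/-- Reflection in a non-isotropic vector. -/
lemma exists_refl {n : ℕ} (a : Fin n → ℂ) (ha : a ⬝ᵥ a ≠ 0) :
    ∃ A : (Fin n → ℂ) →ₗ[ℂ] (Fin n → ℂ), (∀ x y, A x ⬝ᵥ A y = x ⬝ᵥ y) ∧
      ∀ x, A x = x - (2 * (a ⬝ᵥ x) / (a ⬝ᵥ a)) • a := by
  refine ⟨{ toFun := fun x => x - (2 * (a ⬝ᵥ x) / (a ⬝ᵥ a)) • a, map_add' := ?_, map_smul' := ?_ },
    ?_, fun x => rfl⟩
  · intro x y
    rw [dotProduct_add, mul_add, add_div, add_smul]; abel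
  · intro c x
    simp only [dotProduct_smul, smul_eq_mul, RingHom.id_apply, smul_sub, smul_smul]
    congr 2; ring
  · intro x y
    simp only [LinearMap.coe_mk, AddHom.coe_mk, dotProduct_sub, sub_dotProduct, smul_dotProduct,
      dotProduct_smul, smul_eq_mul]
    rw [dotProduct_comm x a]
    field_simp
    ring

/-- A Witt-type lemma. -/
lemma witt {n : ℕ} (u v : Fin n → ℂ) (huv : u ⬝ᵥ u = v ⬝ᵥ v) (hv : v ⬝ᵥ v ≠ 0) :
    ∃ A : (Fin n → ℂ) →ₗ[ℂ] (Fin n → ℂ), (∀ x y, A x ⬝ᵥ A y = x ⬝ᵥ y) ∧ A u = v ∧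
      ∀ z, u ⬝ᵥ z = 0 → v ⬝ᵥ z = 0 → A z = z := by
  have hc := dotProduct_comm u v
  by_cases h : (u - v) ⬝ᵥ (u - v) = 0
  · have h2 : (u + v) ⬝ᵥ (u + v) ≠ 0 := by
      intro h2
      apply hv
      simp only [dotProduct_sub, sub_dotProduct, dotProduct_add, add_dotProduct] at h h2
      linear_combination (h + h2) / 4 - huv / 2
    obtain ⟨A, hA, hA'⟩ := exists_refl (u + v) h2
    obtain ⟨B, hB, hB'⟩ := exists_refl v hv
    refine ⟨B ∘ₗ A, fun x y => by simp [hA, hB], ?_, ?_⟩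
    · have h3 : A u = -v := by
        rw [hA']
        have : 2 * ((u + v) ⬝ᵥ u) / ((u + v) ⬝ᵥ (u + v)) = 1 := by
          rw [div_eq_one_iff_eq h2]
          simp only [dotProduct_add, add_dotProduct]
          linear_combination huv - hc
        rw [this]; simp
      rw [LinearMap.comp_apply, h3, hB']
      have : 2 * (v ⬝ᵥ (-v)) / (v ⬝ᵥ v) = -2 := by
        rw [dotProduct_neg]; field_simp
      rw [this]; ext i; simp; ring
    · intro z h1 h2
      have h3 : A z = z := by rw [hA', add_dotProduct, h1, h2]; simp
      rw [LinearMap.comp_apply, h3, hB', h2]; simp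
  · obtain ⟨A, hA, hA'⟩ := exists_refl (u - v) h
    refine ⟨A, hA, ?_, ?_⟩
    · rw [hA']
      have : 2 * ((u - v) ⬝ᵥ u) / ((u - v) ⬝ᵥ (u - v)) = 1 := by
        rw [div_eq_one_iff_eq h]
        simp only [dotProduct_sub, sub_dotProduct]
        linear_combination huv + hc
      rw [this]; simp
    · intro z h1 h2
      rw [hA', sub_dotProduct, h1, h2]; simp

/-- Vectors with the Gram matrix of a regular simplex span the whole space. -/
lemma perp_zero {n : ℕ} (v : Fin n → Fin n → ℂ)
    (hv : ∀ i j, v i ⬝ᵥ v j = if i = j then 1 else 1 / 2)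
    (w : Fin n → ℂ) (hw : ∀ i, v i ⬝ᵥ w = 0) : w = 0 := by
  let M : Matrix (Fin n) (Fin n) ℂ := Matrix.of v
  let N : Matrix (Fin n) (Fin n) ℂ := Matrix.of fun i j =>
    2 * ((if i = j then 1 else 0) - 1 / ((n : ℂ) + 1))
  have hn : (n : ℂ) + 1 ≠ 0 := by exact_mod_cast Nat.succ_ne_zero n
  have h1 : M * (Mᵀ * N) = 1 := by
    rw [← Matrix.mul_assoc]
    have : M * Mᵀ = Matrix.of fun i j => (if i = j then (1 / 2 : ℂ) else 0) + 1 / 2 := by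
      ext i j
      have := hv i j
      simp only [M, Matrix.mul_apply, Matrix.transpose_apply, Matrix.of_apply]
      rw [dotProduct] at this
      rw [this]; split_ifs <;> norm_num
    rw [this]
    ext i j
    simp only [N, Matrix.mul_apply, Matrix.of_apply, Matrix.one_apply]
    simp only [add_mul, mul_sub, Finset.sum_add_distrib, Finset.sum_sub_distrib, ite_mul, mul_ite,
      zero_mul, mul_zero, Finset.sum_ite_eq, Finset.sum_ite_eq', Finset.mem_univ, if_true,
      Finset.sum_const, Finset.card_univ, Fintype.card_fin, nsmul_eq_mul]
    split_ifs <;> field_simp <;> ring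
  have h2 := mul_eq_one_comm.mp h1
  have h3 : M *ᵥ w = 0 := by
    ext i; exact hw i
  calc w = (1 : Matrix (Fin n) (Fin n) ℂ) *ᵥ w := by simp
    _ = 0 := by rw [← h2, ← Matrix.mulVec_mulVec, h3, Matrix.mulVec_zero]

/-- `p` together with the apex `X` is a regular unit simplex. -/
structure Simp {n : ℕ} (p : Fin n → Fin n → ℂ) (X : Fin n → ℂ) : Prop where
  base : ∀ i j, i ≠ j → (p i - p j) ⬝ᵥ (p i - p j) = 1
  apex : ∀ i, (X - p i) ⬝ᵥ (X - p i) = 1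

lemma Simp.gram {n : ℕ} {p : Fin n → Fin n → ℂ} {X : Fin n → ℂ} (h : Simp p X) (i j : Fin n) :
    (p i - X) ⬝ᵥ (p j - X) = if i = j then 1 else 1 / 2 := by
  have e1 := h.apex i
  have e2 := h.apex j
  split_ifs with hij
  · subst hij
    rw [← e1, ← neg_sub X, neg_dotProduct_neg]
  · have e3 := h.base i j hij
    have c1 := dotProduct_comm (p i) X
    have c2 := dotProduct_comm (p j) X
    have c3 := dotProduct_comm (p i) (p j)
    simp only [dotProduct_sub, sub_dotProduct] at *
    linear_combination (e1 + e2 - e3) / 2 + (c3 + c2 - c1) / 2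

lemma Simp.sig {n : ℕ} {p : Fin n → Fin n → ℂ} {X : Fin n → ℂ} (h : Simp p X) (i : Fin n) :
    (p i - X) ⬝ᵥ (∑ j, (p j - X)) = ((n : ℂ) + 1) / 2 := by
  rw [dotProduct_sum]
  simp only [h.gram]
  have : ∀ j : Fin n, (if i = j then (1 : ℂ) else 1 / 2) = (if i = j then 1 / 2 else 0) + 1 / 2 := by
    intro j; split_ifs <;> norm_num
  simp only [this, Finset.sum_add_distrib]
  simp; ring

lemma Simp.sigsig {n : ℕ} {p : Fin n → Fin n → ℂ} {X : Fin n → ℂ} (h : Simp p X) :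
    (∑ j, (p j - X)) ⬝ᵥ (∑ j, (p j - X)) = n * ((n : ℂ) + 1) / 2 := by
  rw [sum_dotProduct]
  simp only [h.sig]
  simp; ring

lemma sum_sub_eq {n : ℕ} (p : Fin n → Fin n → ℂ) (X : Fin n → ℂ) :
    ∑ j, (p j - X) = (∑ j, p j) - (n : ℂ) • X := by
  rw [Finset.sum_sub_distrib]; ext i; simp

/-- Two apexes over a common base coincide or are mirror images. -/
lemma Simp.two {n : ℕ} (hn : n ≠ 0) {p : Fin n → Fin n → ℂ} {X Y : Fin n → ℂ}
    (hX : Simp p X) (hY : Simp p Y) :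
    X = Y ∨ (X + Y = (2 / (n : ℂ)) • ∑ j, p j ∧ (X - Y) ⬝ᵥ (X - Y) = 2 + 2 / (n : ℂ)) := by
  have hn0 : (n : ℂ) ≠ 0 := by exact_mod_cast hn
  have hn1 : (n : ℂ) + 1 ≠ 0 := by exact_mod_cast Nat.succ_ne_zero n
  set s := ∑ j, (p j - X) with hs
  set z := Y - X with hz
  set k := z ⬝ᵥ z / 2 with hk
  have h1 : ∀ i, (p i - X) ⬝ᵥ z = k := by
    intro i
    have e1 := hX.apex i
    have e2 := hY.apex i
    have c1 := dotProduct_comm (p i) X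
    have c2 := dotProduct_comm (p i) Y
    have c3 := dotProduct_comm X Y
    simp only [hk, hz, dotProduct_sub, sub_dotProduct] at *
    linear_combination (e1 - e2) / 2 + (c2 - c1 - c3) / 2
  have h2 : z - (2 * k / (n + 1)) • s = 0 := by
    refine perp_zero (fun i => p i - X) hX.gram _ fun i => ?_
    rw [dotProduct_sub, h1, dotProduct_smul, hs, hX.sig]
    simp only [smul_eq_mul]; field_simp; ring
  have h3 : z = (2 * k / (n + 1)) • s := sub_eq_zero.mp h2
  set t := 2 * k / ((n : ℂ) + 1) with ht
  have h4 : t * (t - 2 / n) = 0 := by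
    have h5 : z ⬝ᵥ z = t * t * (n * ((n : ℂ) + 1) / 2) := by
      rw [h3, dotProduct_smul, smul_dotProduct, hX.sigsig]; simp only [smul_eq_mul]; ring
    have h6 : z ⬝ᵥ z = t * (n + 1) := by
      rw [ht, hk]; field_simp
    have h7 : t * (t * n / 2 - 1) * (n + 1) = 0 := by
      linear_combination h6 - h5
    have h8 := (mul_eq_zero.mp h7).resolve_right hn1
    field_simp
    linear_combination 2 * h8
  rcases mul_eq_zero.mp h4 with h | h
  · left
    rw [h, zero_smul] at h3
    exact (sub_eq_zero.mp h3).symm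
  · right
    have h5 : t = 2 / n := sub_eq_zero.mp h
    rw [h5] at h3
    constructor
    · have : Y = X + (2 / (n : ℂ)) • s := by rw [← h3, hz]; abel
      rw [this, hs, sum_sub_eq, smul_sub, smul_smul, div_mul_cancel₀ _ hn0, two_smul]
      abel
    · rw [← neg_sub Y X, neg_dotProduct_neg, ← hz, h3, dotProduct_smul, smul_dotProduct, hX.sigsig]
      simp only [smul_eq_mul]; field_simp

/-- The mirror image is again an apex. -/
lemma Simp.mirror {n : ℕ} (hn : n ≠ 0) {p : Fin n → Fin n → ℂ} {X : Fin n → ℂ}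
    (hX : Simp p X) : Simp p ((2 / (n : ℂ)) • (∑ j, p j) - X) := by
  have hn0 : (n : ℂ) ≠ 0 := by exact_mod_cast hn
  refine ⟨hX.base, fun i => ?_⟩
  have : (2 / (n : ℂ)) • (∑ j, p j) - X - p i = (2 / (n : ℂ)) • (∑ j, (p j - X)) - (p i - X) := by
    rw [sum_sub_eq, smul_sub, smul_smul, div_mul_cancel₀ _ hn0, two_smul]; abel
  rw [this]
  have c := dotProduct_comm (∑ j, (p j - X)) (p i - X)
  have g1 := hX.gram i i
  have g2 := hX.sig i
  have g3 := hX.sigsig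
  generalize p i - X = q at *
  generalize ∑ j, (p j - X) = s at *
  rw [if_pos rfl] at g1
  rw [sub_dotProduct, dotProduct_sub, dotProduct_sub, smul_dotProduct, dotProduct_smul,
    smul_dotProduct, dotProduct_smul, c, g1, g2, g3]
  simp only [smul_eq_mul]; field_simp; ring

lemma Simp.map {n : ℕ} {f : (Fin n → ℂ) → (Fin n → ℂ)} (hf : Pres n f 1)
    {p : Fin n → Fin n → ℂ} {X : Fin n → ℂ} (h : Simp p X) : Simp (fun i => f (p i)) (f X) :=
  ⟨fun i j hij => hf _ _ (h.base i j hij), fun i => hf _ _ (h.apex i)⟩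

lemma onb {n : ℕ} (w : Fin n → ℂ) (hw : w ⬝ᵥ w ≠ 0) (i0 : Fin n) :
    ∃ e : Fin n → Fin n → ℂ, (∀ i j, e i ⬝ᵥ e j = if i = j then 1 else 0) ∧
      ∃ c : ℂ, w = c • e i0 := by
  obtain ⟨c, hc⟩ := IsAlgClosed.exists_pow_nat_eq (w ⬝ᵥ w) (n := 2) (by norm_num)
  obtain ⟨A, hA, hA1, -⟩ := witt (c • (Pi.single i0 1 : Fin n → ℂ)) w
    (by rw [← hc]; simp; ring) hw
  refine ⟨fun i => A (Pi.single i 1), fun i j => ?_, c, ?_⟩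
  · rw [hA]; simp [Pi.single_apply, eq_comm]
  · rw [← hA1, map_smul]

/-- In dimension at least two, a point at prescribed distances of two given points. -/
lemma exists_pt {n : ℕ} (hn : 2 ≤ n) (w : Fin n → ℂ) (hw : w ⬝ᵥ w ≠ 0) (c d : ℂ) :
    ∃ y : Fin n → ℂ, y ⬝ᵥ y = c ∧ (y - w) ⬝ᵥ (y - w) = d := by
  obtain ⟨e, he, k, hk⟩ := onb w hw ⟨0, by omega⟩
  set z := e ⟨1, by omega⟩ with hz
  have h1 : z ⬝ᵥ z = 1 := by rw [hz, he]; simp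
  have h2 : w ⬝ᵥ z = 0 := by rw [hk, smul_dotProduct, hz, he]; simp
  have h3 : z ⬝ᵥ w = 0 := by rw [dotProduct_comm, h2]
  set a := (c + w ⬝ᵥ w - d) / (2 * (w ⬝ᵥ w)) with ha
  have ha' : 2 * a * (w ⬝ᵥ w) = c + w ⬝ᵥ w - d := by rw [ha]; field_simp
  obtain ⟨b, hb⟩ := IsAlgClosed.exists_pow_nat_eq (c - a ^ 2 * (w ⬝ᵥ w)) (n := 2) (by norm_num)
  refine ⟨a • w + b • z, ?_, ?_⟩
  · simp only [dotProduct_add, add_dotProduct, smul_dotProduct, dotProduct_smul, smul_eq_mul,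
      h1, h2, h3]
    linear_combination hb
  · simp only [dotProduct_add, add_dotProduct, smul_dotProduct, dotProduct_smul, smul_eq_mul,
      dotProduct_sub, sub_dotProduct, h1, h2, h3]
    linear_combination hb - ha'

lemma exists_std {n : ℕ} (hn : 2 ≤ n) :
    ∃ (p : Fin n → Fin n → ℂ) (X Y : Fin n → ℂ), Simp p X ∧ Simp p Y ∧ X ≠ Y := by
  have hn0 : (n : ℂ) ≠ 0 := by exact_mod_cast (by omega : n ≠ 0)
  have hn1 : (n : ℂ) + 1 ≠ 0 := by exact_mod_cast Nat.succ_ne_zero n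
  obtain ⟨r, hr⟩ := IsAlgClosed.exists_pow_nat_eq (1 / 2 : ℂ) (n := 2) (by norm_num)
  obtain ⟨δ, hδ⟩ := IsAlgClosed.exists_pow_nat_eq (((n : ℂ) + 1) / 2) (n := 2) (by norm_num)
  have key : ∀ a : ℂ, n * a ^ 2 - 2 * r * a = 1 / 2 →
      Simp (fun i => (Pi.single i r : Fin n → ℂ)) (fun _ => a) := by
    intro a ha
    constructor
    · intro i j hij
      simp only [dotProduct_sub, sub_dotProduct, dotProduct_single, single_dotProduct,
        Pi.single_apply]
      simp [hij, hij.symm]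
      linear_combination 2 * hr
    · intro i
      have : (fun _ => a : Fin n → ℂ) ⬝ᵥ (fun _ => a) = n * a ^ 2 := by
        simp [dotProduct, pow_two]
      rw [dotProduct_sub, sub_dotProduct, sub_dotProduct, this]
      simp only [dotProduct_single, single_dotProduct, Pi.single_eq_same]
      linear_combination ha + hr
  refine ⟨_, _, _, key ((r + δ) / n) ?_, key ((r - δ) / n) ?_, ?_⟩
  · field_simp
    linear_combination 2 * hδ - 2 * hr
  · field_simp
    linear_combination 2 * hδ - 2 * hr
  · intro h
    have h1 := congrFun h ⟨0, by omega⟩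
    field_simp at h1
    have : δ = 0 := by linear_combination h1 / 2
    rw [this] at hδ
    apply hn1
    linear_combination -2 * hδ

lemma exists_simp {n : ℕ} (hn : 2 ≤ n) (i0 : Fin n) (P0 P1 P2 : Fin n → ℂ)
    (h01 : (P0 - P1) ⬝ᵥ (P0 - P1) = 1) (h12 : (P1 - P2) ⬝ᵥ (P1 - P2) = 1)
    (h02 : (P0 - P2) ⬝ᵥ (P0 - P2) = 2 + 2 / (n : ℂ)) :
    ∃ p : Fin n → Fin n → ℂ, p i0 = P1 ∧ Simp p P0 ∧ Simp p P2 := by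
  have hn0 : (n : ℂ) ≠ 0 := by exact_mod_cast (by omega : n ≠ 0)
  have hn1 : (n : ℂ) + 1 ≠ 0 := by exact_mod_cast Nat.succ_ne_zero n
  have hn2 : (n : ℂ) - 1 ≠ 0 := by
    rw [sub_ne_zero]; exact_mod_cast (by omega : n ≠ 1)
  have hD : (2 + 2 / (n : ℂ)) ≠ 0 := by
    intro h; apply hn1; field_simp at h; linear_combination h / 2
  obtain ⟨p, S0, S2, hS0, hS2, hne⟩ := exists_std hn
  have hSD := ((hS0.two (by omega) hS2).resolve_left hne).2
  obtain ⟨A, hA, hA1, -⟩ := witt (S0 - S2) (P0 - P2) (by rw [hSD, h02]) (by rw [h02]; exact hD)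
  have q01 : A (S0 - p i0) ⬝ᵥ A (S0 - p i0) = 1 := by rw [hA]; exact hS0.apex i0
  have q12 : (A (S0 - p i0) - (P0 - P2)) ⬝ᵥ (A (S0 - p i0) - (P0 - P2)) = 1 := by
    rw [← hA1, ← map_sub, hA]
    have : S0 - p i0 - (S0 - S2) = S2 - p i0 := by abel
    rw [this]; exact hS2.apex i0
  have q12' : ((P0 - P1) - (P0 - P2)) ⬝ᵥ ((P0 - P1) - (P0 - P2)) = 1 := by
    have : (P0 - P1) - (P0 - P2) = -(P1 - P2) := by abel
    rw [this, neg_dotProduct_neg]; exact h12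
  set u := P0 - P2 with hu
  set g := A (S0 - p i0) with hg
  set h := P0 - P1 with hh
  have c1 := dotProduct_comm u g
  have c2 := dotProduct_comm u h
  have d1 : u ⬝ᵥ g = (2 + 2 / (n : ℂ)) / 2 := by
    simp only [dotProduct_sub, sub_dotProduct] at q12
    linear_combination (h02 + q01 - q12 + c1) / 2
  have d2 : u ⬝ᵥ h = (2 + 2 / (n : ℂ)) / 2 := by
    simp only [dotProduct_sub, sub_dotProduct] at q12'
    linear_combination (h02 + h01 - q12' + c2) / 2
  have e1 : (g - (1 / 2 : ℂ) • u) ⬝ᵥ (g - (1 / 2 : ℂ) • u) = 1 - (2 + 2 / (n : ℂ)) / 4 := by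
    simp only [dotProduct_sub, sub_dotProduct, smul_dotProduct, dotProduct_smul, smul_eq_mul]
    linear_combination q01 + h02 / 4 - d1 + c1 / 2
  have e2 : (h - (1 / 2 : ℂ) • u) ⬝ᵥ (h - (1 / 2 : ℂ) • u) = 1 - (2 + 2 / (n : ℂ)) / 4 := by
    simp only [dotProduct_sub, sub_dotProduct, smul_dotProduct, dotProduct_smul, smul_eq_mul]
    linear_combination h01 + h02 / 4 - d2 + c2 / 2
  obtain ⟨B, hB, hB1, hB2⟩ := witt (g - (1 / 2 : ℂ) • u) (h - (1 / 2 : ℂ) • u) (by rw [e1, e2]) (by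
    rw [e2]; intro h0; apply hn2; field_simp at h0; linear_combination h0 / 2)
  have hBu : B u = u := by
    apply hB2
    · simp only [sub_dotProduct, smul_dotProduct, smul_eq_mul]
      linear_combination d1 - h02 / 2 - c1
    · simp only [sub_dotProduct, smul_dotProduct, smul_eq_mul]
      linear_combination d2 - h02 / 2 - c2
  have hBg : B g = h := by
    rw [map_sub, map_smul, hBu] at hB1
    exact sub_left_injective hB1
  have hBA : ∀ x y, B (A x) ⬝ᵥ B (A y) = x ⬝ᵥ y := fun x y => by rw [hB, hA]
  have tr : ∀ X, Simp p X →
      Simp (fun i => P0 + B (A (p i - S0))) (P0 + B (A (X - S0))) := by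
    intro X hX
    constructor
    · intro i j hij
      rw [add_sub_add_left_eq_sub, ← map_sub, ← map_sub, hBA, sub_sub_sub_cancel_right]
      exact hX.base i j hij
    · intro i
      rw [add_sub_add_left_eq_sub, ← map_sub, ← map_sub, hBA, sub_sub_sub_cancel_right]
      exact hX.apex i
  refine ⟨fun i => P0 + B (A (p i - S0)), ?_, ?_, ?_⟩
  · have : p i0 - S0 = -(S0 - p i0) := by abel
    simp only [this, map_neg]
    rw [← hg, hBg, hh]; abel
  · simpa using tr S0 hS0
  · have := tr S2 hS2
    have h3 : S2 - S0 = -(S0 - S2) := by abel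
    rw [h3, map_neg, map_neg, hA1, hBu, hu] at this
    convert this using 1
    abel

lemma D_ne_zero {n : ℕ} (hn : 2 ≤ n) : (2 + 2 / (n : ℂ)) ≠ 0 := by
  have hn0 : (n : ℂ) ≠ 0 := by exact_mod_cast (by omega : n ≠ 0)
  have hn1 : (n : ℂ) + 1 ≠ 0 := by exact_mod_cast Nat.succ_ne_zero n
  intro h; apply hn1; field_simp at h; linear_combination h / 2

lemma D_ne_one {n : ℕ} (hn : 2 ≤ n) : (2 + 2 / (n : ℂ)) ≠ 1 := by
  have hn0 : (n : ℂ) ≠ 0 := by exact_mod_cast (by omega : n ≠ 0)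
  have hn1 : (n : ℂ) + 2 ≠ 0 := by exact_mod_cast Nat.succ_ne_zero (n + 1)
  intro h; apply hn1; field_simp at h; linear_combination h

lemma weakD {n : ℕ} (hn : 2 ≤ n) {f : (Fin n → ℂ) → (Fin n → ℂ)} (hf : Pres n f 1)
    (X Y : Fin n → ℂ) (h : (X - Y) ⬝ᵥ (X - Y) = 2 + 2 / (n : ℂ)) :
    f X = f Y ∨ (f X - f Y) ⬝ᵥ (f X - f Y) = 2 + 2 / (n : ℂ) := by
  obtain ⟨y, hy1, hy2⟩ := exists_pt hn (X - Y) (by rw [h]; exact D_ne_zero hn) 1 1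
  obtain ⟨p, -, h1, h2⟩ := exists_simp hn ⟨0, by omega⟩ X (X - y) Y
    (by simpa using hy1)
    (by rw [← hy2, ← neg_dotProduct_neg]; congr 1 <;> abel) h
  rcases (h1.map hf).two (by omega) (h2.map hf) with h3 | h3
  · exact Or.inl h3
  · exact Or.inr h3.2

lemma presD {n : ℕ} (hn : 2 ≤ n) {f : (Fin n → ℂ) → (Fin n → ℂ)} (hf : Pres n f 1) :
    Pres n f (2 + 2 / (n : ℂ)) := by
  intro X Y h
  rcases weakD hn hf X Y h with h1 | h1
  · exfalso
    obtain ⟨y, hy1, hy2⟩ := exists_pt hn (X - Y) (by rw [h]; exact D_ne_zero hn)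
      (2 + 2 / (n : ℂ)) 1
    have h2 := hf (X - y) Y (by rw [← hy2, ← neg_dotProduct_neg]; congr 1 <;> abel)
    rw [← h1] at h2
    rcases weakD hn hf X (X - y) (by simpa using hy1) with h3 | h3
    · rw [h3] at h2; simp at h2
    · rw [← neg_dotProduct_neg, neg_sub, h2] at h3
      exact D_ne_one hn h3.symm
  · exact h1

lemma bip {n : ℕ} (hn : 2 ≤ n) {f : (Fin n → ℂ) → (Fin n → ℂ)} (hf : Pres n f 1)
    {p : Fin n → Fin n → ℂ} {X Y : Fin n → ℂ} (hX : Simp p X) (hY : Simp p Y)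
    (h : (X - Y) ⬝ᵥ (X - Y) = 2 + 2 / (n : ℂ)) :
    f X + f Y = (2 / (n : ℂ)) • ∑ j, f (p j) := by
  rcases (hX.map hf).two (by omega) (hY.map hf) with h1 | h1
  · have := presD hn hf X Y h
    rw [h1] at this
    simp only [sub_self, dotProduct_zero] at this
    exact absurd this.symm (D_ne_zero hn)
  · exact h1.1

lemma ne_of_D {n : ℕ} (hn : 2 ≤ n) {X Y : Fin n → ℂ}
    (h : (X - Y) ⬝ᵥ (X - Y) = 2 + 2 / (n : ℂ)) : X ≠ Y := by
  rintro rfl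
  simp only [sub_self, dotProduct_zero] at h
  exact D_ne_zero hn h.symm

/-- Trapezoids are mapped affinely. -/
lemma trap {n : ℕ} (hn : 2 ≤ n) {f : (Fin n → ℂ) → (Fin n → ℂ)} (hf : Pres n f 1)
    (P0 P1 P2 : Fin n → ℂ)
    (h01 : (P0 - P1) ⬝ᵥ (P0 - P1) = 1) (h12 : (P1 - P2) ⬝ᵥ (P1 - P2) = 1)
    (h02 : (P0 - P2) ⬝ᵥ (P0 - P2) = 2 + 2 / (n : ℂ)) :
    f (P0 + (1 + 2 / (n : ℂ)) • (P2 - P1)) = f P0 + (1 + 2 / (n : ℂ)) • (f P2 - f P1) := by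
  have hn' : n ≠ 0 := by omega
  let i0 : Fin n := ⟨0, by omega⟩
  obtain ⟨p, hp, hS0, hS2⟩ := exists_simp hn i0 P0 P1 P2 h01 h12 h02
  have b1 := bip hn hf hS0 hS2 h02
  have a1 := ((hS0.two hn' hS2).resolve_left (ne_of_D hn h02)).1
  let pp : Fin n → Fin n → ℂ := Function.update p i0 P2
  have hpzero : pp i0 = P2 := by simp [pp]
  have hpother : ∀ i, i ≠ i0 → pp i = p i := fun i hi => by simp [pp, hi]
  have hS1 : Simp pp P1 := by
    constructor
    · intro i j hij
      by_cases hi : i = i0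
      · have hj : j ≠ i0 := fun h => hij (hi.trans h.symm)
        rw [hi, hpzero, hpother j hj]; exact hS2.apex j
      · by_cases hj : j = i0
        · rw [hj, hpzero, hpother i hi, ← neg_dotProduct_neg, neg_sub]; exact hS2.apex i
        · rw [hpother i hi, hpother j hj]; exact hS2.base i j hij
    · intro i
      by_cases hi : i = i0
      · rw [hi, hpzero]; exact h12
      · rw [hpother i hi, ← hp]; exact hS2.base i0 i (Ne.symm hi)
  have hS3 := hS1.mirror hn'
  have sumg : ∀ g : (Fin n → ℂ) → (Fin n → ℂ),
      ∑ j, g (pp j) = ∑ j, g (p j) + (g P2 - g P1) := by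
    intro g
    rw [← Finset.add_sum_erase _ _ (Finset.mem_univ i0),
      ← Finset.add_sum_erase Finset.univ (fun j => g (p j)) (Finset.mem_univ i0)]
    have : ∑ x ∈ Finset.univ.erase i0, g (pp x) = ∑ x ∈ Finset.univ.erase i0, g (p x) := by
      refine Finset.sum_congr rfl fun x hx => ?_
      rw [hpother x (Finset.ne_of_mem_erase hx)]
    rw [this, hpzero, hp]; abel
  have hP3 : (2 / (n : ℂ)) • (∑ j, pp j) - P1 = P0 + (1 + 2 / (n : ℂ)) • (P2 - P1) := by
    rw [sumg (fun x => x), smul_add, ← a1, add_smul, one_smul]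
    abel
  rw [hP3] at hS3
  have hne : P1 ≠ P0 + (1 + 2 / (n : ℂ)) • (P2 - P1) := by
    intro h
    have hn0 : (n : ℂ) ≠ 0 := by exact_mod_cast hn'
    have hn1 : (n : ℂ) + 1 ≠ 0 := by exact_mod_cast Nat.succ_ne_zero n
    have hs := hS1.sigsig
    rw [sum_sub_eq] at hs
    rw [← hP3] at h
    have h5 : ∑ j, pp j = (n : ℂ) • P1 := by
      have : (2 / (n : ℂ)) • (∑ j, pp j) = (2 : ℂ) • P1 := by
        rw [two_smul]; nth_rewrite 1 [h]; abel
      calc ∑ j, pp j = ((n : ℂ) / 2) • (2 / (n : ℂ)) • (∑ j, pp j) := by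
            rw [smul_smul]
            have : ((n : ℂ) / 2) * (2 / (n : ℂ)) = 1 := by field_simp
            rw [this, one_smul]
        _ = _ := by rw [this, smul_smul]; congr 1; ring
    rw [h5] at hs
    simp only [sub_self, dotProduct_zero] at hs
    field_simp at hs
    rcases mul_eq_zero.mp (by linear_combination -hs : (n : ℂ) * (n + 1) = 0) with h | h
    · exact hn0 h
    · exact hn1 h
  have h13 := ((hS1.two hn' hS3).resolve_left hne).2
  have b2 := bip hn hf hS1 hS3 h13
  rw [sumg f, smul_add, ← b1] at b2
  have := eq_sub_of_add_eq' b2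
  rw [this, add_smul, one_smul]; abel

lemma lam_ne_zero {n : ℕ} (hn : 2 ≤ n) : (1 + 2 / (n : ℂ)) ≠ 0 := by
  have hn0 : (n : ℂ) ≠ 0 := by exact_mod_cast (by omega : n ≠ 0)
  have hn1 : (n : ℂ) + 2 ≠ 0 := by exact_mod_cast Nat.succ_ne_zero (n + 1)
  intro h; apply hn1; field_simp at h; linear_combination h

lemma presL {n : ℕ} (hn : 2 ≤ n) {f : (Fin n → ℂ) → (Fin n → ℂ)} (hf : Pres n f 1) :
    Pres n f ((1 + 2 / (n : ℂ)) ^ 2) := by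
  intro X Y h
  have hl := lam_ne_zero hn
  have hT := trap hn hf
  generalize 1 + 2 / (n : ℂ) = l at *
  set u := l⁻¹ • (X - Y) with hu
  have hu1 : u ⬝ᵥ u = 1 := by
    rw [hu, smul_dotProduct, dotProduct_smul, h]; simp only [smul_eq_mul]; field_simp
  obtain ⟨y, hy1, hy2⟩ := exists_pt hn (-u) (by rw [neg_dotProduct_neg, hu1]; exact one_ne_zero)
      1 (2 + 2 / (n : ℂ))
  have := hT Y (Y + y) (Y + y + u) (by simpa using hy1) (by simpa using hu1) (by
    rw [← hy2, ← neg_dotProduct_neg]; congr 1 <;> abel)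
  have e : Y + l • (Y + y + u - (Y + y)) = X := by
    rw [add_sub_cancel_left, hu, smul_smul, mul_inv_cancel₀ hl, one_smul]; abel
  rw [e] at this
  rw [this, add_sub_cancel_left, smul_dotProduct, dotProduct_smul, hf]
  · simp only [smul_eq_mul]; ring
  · simpa using hu1

lemma ap2 {f : (Fin 2 → ℂ) → (Fin 2 → ℂ)} (hf : Pres 2 f 1) (A u : Fin 2 → ℂ)
    (hu : u ⬝ᵥ u = 1) : f (A + (2 : ℂ) • u) = f A + (2 : ℂ) • (f (A + u) - f A) := by
  obtain ⟨y, hy1, hy2⟩ := exists_pt le_rfl u (by rw [hu]; exact one_ne_zero) 1 1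
  have c := dotProduct_comm y u
  have hyu : (y + u) ⬝ᵥ (y + u) = 2 + 2 / ((2 : ℕ) : ℂ) := by
    simp only [dotProduct_sub, sub_dotProduct] at hy2
    simp only [dotProduct_add, add_dotProduct]
    push_cast
    linear_combination 2 * hy1 + 2 * hu - hy2
  have hD : (A - (A + y + u)) ⬝ᵥ (A - (A + y + u)) = 2 + 2 / ((2 : ℕ) : ℂ) := by
    rw [← hyu, ← neg_dotProduct_neg]; congr 1 <;> abel
  have h1 := trap le_rfl hf A (A + y) (A + y + u) (by simpa using hy1) (by simpa using hu) hD
  have hS0 : Simp ![A + y, A + u] A := by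
    constructor
    · intro i j hij
      have hy3 : (u - y) ⬝ᵥ (u - y) = 1 := by
        rw [← neg_dotProduct_neg, neg_sub]; exact hy2
      fin_cases i <;> fin_cases j
      · exact absurd rfl hij
      · simpa using hy2
      · simpa using hy3
      · exact absurd rfl hij
    · intro i
      fin_cases i
      · simpa using hy1
      · simpa using hu
  have hS2 : Simp ![A + y, A + u] (A + y + u) := by
    refine ⟨hS0.base, ?_⟩
    intro i
    fin_cases i
    · simpa using hu
    · have : A + y + u - (A + u) = y := by abel
      simpa [this] using hy1
  have h2 := bip le_rfl hf hS0 hS2 hD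
  have e : (1 + 2 / ((2 : ℕ) : ℂ)) = 2 := by norm_num
  rw [e, add_sub_cancel_left] at h1
  rw [h1]
  have e2 : (2 / ((2 : ℕ) : ℂ)) = 1 := by norm_num
  rw [e2, one_smul, Fin.sum_univ_two] at h2
  simp only [Matrix.cons_val_zero, Matrix.cons_val_one] at h2
  have h3 : f (A + y + u) = f (A + y) + f (A + u) - f A := by rw [← h2]; abel
  rw [h3]; congr 2; abel

lemma div2 {f : (Fin 2 → ℂ) → (Fin 2 → ℂ)} (hf : Pres 2 f 1) (t : ℂ) (ht : t ≠ 0)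
    (h : Pres 2 f (4 * t)) : Pres 2 f t := by
  intro X Y hXY
  obtain ⟨y, hy1, hy2⟩ := exists_pt le_rfl (X - Y) (by rw [hXY]; exact ht) 1 1
  have h1 := ap2 hf (X - y) y hy1
  have h2 := ap2 hf (X - y) (y - (X - Y)) hy2
  have e1 : X - y + y = X := by abel
  have e2 : X - y + (y - (X - Y)) = Y := by abel
  rw [e1] at h1
  rw [e2] at h2
  have h3 := h (X - y + (2 : ℂ) • y) (X - y + (2 : ℂ) • (y - (X - Y))) (by
    rw [add_sub_add_left_eq_sub, ← smul_sub, sub_sub_cancel, smul_dotProduct, dotProduct_smul, hXY]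
    simp only [smul_eq_mul]; ring)
  rw [h1, h2, add_sub_add_left_eq_sub, ← smul_sub, sub_sub_sub_cancel_right, smul_dotProduct,
    dotProduct_smul] at h3
  simp only [smul_eq_mul] at h3
  linear_combination h3 / 4

lemma exists_q {n : ℕ} (hn : 3 ≤ n) (w : Fin n → ℂ) (t : ℂ) (hw : w ⬝ᵥ w = t) (ht : t ≠ 0) :
    ∃ q0 q1 : Fin n → ℂ, q1 ⬝ᵥ q1 = 1 - t / 4 ∧ q0 ⬝ᵥ q0 = 2 + 2 / (n : ℂ) - t / 4 ∧
      2 * (q0 ⬝ᵥ q1) = 2 + 2 / (n : ℂ) - t / 2 ∧ w ⬝ᵥ q0 = 0 ∧ w ⬝ᵥ q1 = 0 := by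
  have hn0 : (n : ℂ) ≠ 0 := by exact_mod_cast (by omega : n ≠ 0)
  obtain ⟨e, he, k, hk⟩ := onb w (by rw [hw]; exact ht) ⟨0, by omega⟩
  set x := e ⟨1, by omega⟩ with hx
  set y := e ⟨2, by omega⟩ with hy
  have hxx : x ⬝ᵥ x = 1 := by rw [hx, he]; simp
  have hyy : y ⬝ᵥ y = 1 := by rw [hy, he]; simp
  have hxy : x ⬝ᵥ y = 0 := by rw [hx, hy, he]; simp
  have hyx : y ⬝ᵥ x = 0 := by rw [dotProduct_comm]; exact hxy
  have hwx : w ⬝ᵥ x = 0 := by rw [hk, smul_dotProduct, hx, he]; simp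
  have hwy : w ⬝ᵥ y = 0 := by rw [hk, smul_dotProduct, hy, he]; simp
  by_cases h4 : t = 4
  · subst h4
    set a : ℂ := 1 / n with ha
    set b : ℂ := n * (1 + 2 / n) with hb
    have hab : a * b = 1 + 2 / n := by rw [ha, hb]; field_simp
    have ha2 : 2 / (n : ℂ) = 2 * a := by rw [ha]; ring
    refine ⟨((a + b) / 2) • x + (-Complex.I * (a - b) / 2) • y, x + Complex.I • y,
      ?_, ?_, ?_, ?_, ?_⟩ <;>
    simp only [dotProduct_add, add_dotProduct, smul_dotProduct, dotProduct_smul, smul_eq_mul,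
      hxx, hyy, hxy, hyx, hwx, hwy]
    · linear_combination Complex.I_sq
    · linear_combination hab + (a - b) ^ 2 / 4 * Complex.I_sq
    · linear_combination - (a - b) * Complex.I_sq - ha2
    · ring
    · ring
  · obtain ⟨a, ha⟩ := IsAlgClosed.exists_pow_nat_eq (1 - t / 4) (n := 2) (by norm_num)
    have ha0 : a ≠ 0 := by
      rintro rfl
      apply h4
      linear_combination 4 * ha
    set b := (2 + 2 / (n : ℂ) - t / 2) / (2 * a) with hb
    have hab : 2 * (a * b) = 2 + 2 / (n : ℂ) - t / 2 := by rw [hb]; field_simp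
    obtain ⟨c, hc⟩ := IsAlgClosed.exists_pow_nat_eq (2 + 2 / (n : ℂ) - t / 4 - b ^ 2) (n := 2)
      (by norm_num)
    refine ⟨b • x + c • y, a • x, ?_, ?_, ?_, ?_, ?_⟩ <;>
    simp only [dotProduct_add, add_dotProduct, smul_dotProduct, dotProduct_smul, smul_eq_mul,
      hxx, hyy, hxy, hyx, hwx, hwy]
    · linear_combination ha
    · linear_combination hc
    · linear_combination hab
    · ring
    · ring

lemma div3 {n : ℕ} (hn : 3 ≤ n) {f : (Fin n → ℂ) → (Fin n → ℂ)} (hf : Pres n f 1)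
    (t : ℂ) (ht : t ≠ 0) (h : Pres n f ((1 + 2 / (n : ℂ)) ^ 2 * t)) : Pres n f t := by
  intro X Y hXY
  obtain ⟨q0, q1, h11, h00, h01, hw0, hw1⟩ := exists_q hn (X - Y) t hXY ht
  have hl := lam_ne_zero (n := n) (by omega)
  have hT := trap (by omega) hf
  set m := Y + (1 / 2 : ℂ) • (X - Y) with hm
  have hmX : X = m + (1 / 2 : ℂ) • (X - Y) := by
    rw [hm]; ext i; simp; ring
  have hmY : Y = m - (1 / 2 : ℂ) • (X - Y) := by rw [hm]; abel
  set w := X - Y with hw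
  have c0 := dotProduct_comm w q0
  have c1 := dotProduct_comm w q1
  have c2 := dotProduct_comm q0 q1
  have hP01 : ((m + q0) - (m + q1)) ⬝ᵥ ((m + q0) - (m + q1)) = 1 := by
    rw [add_sub_add_left_eq_sub]
    simp only [dotProduct_sub, sub_dotProduct]
    linear_combination h11 + h00 - h01 + c2
  have t1 := hT (m + q0) (m + q1) X hP01 (by
      have : m + q1 - X = q1 - (1 / 2 : ℂ) • w := by nth_rewrite 1 [hmX]; abel
      rw [this]
      simp only [dotProduct_sub, sub_dotProduct, smul_dotProduct, dotProduct_smul, smul_eq_mul]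
      linear_combination h11 + hXY / 4 - hw1 + c1 / 2) (by
      have : m + q0 - X = q0 - (1 / 2 : ℂ) • w := by nth_rewrite 1 [hmX]; abel
      rw [this]
      simp only [dotProduct_sub, sub_dotProduct, smul_dotProduct, dotProduct_smul, smul_eq_mul]
      linear_combination h00 + hXY / 4 - hw0 + c0 / 2)
  have t2 := hT (m + q0) (m + q1) Y hP01 (by
      have : m + q1 - Y = q1 + (1 / 2 : ℂ) • w := by nth_rewrite 1 [hmY]; abel
      rw [this]
      simp only [dotProduct_add, add_dotProduct, smul_dotProduct, dotProduct_smul, smul_eq_mul]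
      linear_combination h11 + hXY / 4 + hw1 - c1 / 2) (by
      have : m + q0 - Y = q0 + (1 / 2 : ℂ) • w := by nth_rewrite 1 [hmY]; abel
      rw [this]
      simp only [dotProduct_add, add_dotProduct, smul_dotProduct, dotProduct_smul, smul_eq_mul]
      linear_combination h00 + hXY / 4 + hw0 - c0 / 2)
  generalize 1 + 2 / (n : ℂ) = l at *
  have h3 := h (m + q0 + l • (X - (m + q1))) (m + q0 + l • (Y - (m + q1))) (by
    rw [add_sub_add_left_eq_sub, ← smul_sub, sub_sub_sub_cancel_right, smul_dotProduct,
      dotProduct_smul, ← hw, hXY]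
    simp only [smul_eq_mul]; ring)
  rw [t1, t2, add_sub_add_left_eq_sub, ← smul_sub, sub_sub_sub_cancel_right, smul_dotProduct,
    dotProduct_smul] at h3
  simp only [smul_eq_mul] at h3
  have hl2 : l ^ 2 ≠ 0 := pow_ne_zero 2 hl
  apply mul_left_cancel₀ hl2
  linear_combination h3

lemma presDiv {n : ℕ} (hn : 2 ≤ n) {f : (Fin n → ℂ) → (Fin n → ℂ)} (hf : Pres n f 1)
    (t : ℂ) (ht : t ≠ 0) (h : Pres n f ((1 + 2 / (n : ℂ)) ^ 2 * t)) : Pres n f t := by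
  rcases eq_or_lt_of_le hn with h2 | h2
  · subst h2
    refine div2 hf t ht ?_
    convert h using 2
    norm_num
  · exact div3 h2 hf t ht h

lemma scale {n : ℕ} (s : ℂ)
    (H : ∀ f : (Fin n → ℂ) → (Fin n → ℂ), Pres n f 1 → Pres n f s)
    (f : (Fin n → ℂ) → (Fin n → ℂ)) (t : ℂ) (ht : t ≠ 0) (hf : Pres n f t) :
    Pres n f (s * t) := by
  obtain ⟨r, hr⟩ := IsAlgClosed.exists_pow_nat_eq t (n := 2) (by norm_num)
  have hr0 : r ≠ 0 := by
    rintro rfl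
    apply ht; rw [← hr]; norm_num
  have key : ∀ c, Pres n (fun x => r⁻¹ • f (r • x)) c ↔ Pres n f (c * t) := by
    intro c
    constructor
    · intro h X Y hXY
      have := h (r⁻¹ • X) (r⁻¹ • Y) (by
        rw [← smul_sub, smul_dotProduct, dotProduct_smul, hXY, ← hr]
        simp only [smul_eq_mul]; field_simp)
      simp only [smul_smul, mul_inv_cancel₀ hr0, one_smul] at this
      rw [← smul_sub, smul_dotProduct, dotProduct_smul] at this
      simp only [smul_eq_mul] at this
      rw [← hr, ← this]; field_simp
    · intro h X Y hXY
      have := h (r • X) (r • Y) (by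
        rw [← smul_sub, smul_dotProduct, dotProduct_smul, hXY, ← hr]
        simp only [smul_eq_mul]; ring)
      simp only
      rw [← smul_sub, smul_dotProduct, dotProduct_smul, this, ← hr]
      simp only [smul_eq_mul]; field_simp
  rw [← key]
  apply H
  rw [key, one_mul]
  exact hf

lemma irr {n : ℕ} (hn : 2 ≤ n) :
    Irrational (Real.log (2 + 2 / n) / Real.log ((1 + 2 / n) ^ 2)) := by
  have hn0 : (0 : ℝ) < n := by exact_mod_cast (by omega : 0 < n)
  have hd : (0 : ℝ) < 2 / n := by positivity
  have l1 : 0 < Real.log (2 + 2 / n) := Real.log_pos (by linarith)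
  have l2 : 0 < Real.log ((1 + 2 / n : ℝ) ^ 2) := Real.log_pos (by nlinarith)
  rintro ⟨q, hq⟩
  have hqpos : 0 < q := by
    have : (0 : ℝ) < q := by rw [hq]; positivity
    exact_mod_cast this
  obtain ⟨a, ha⟩ : ∃ a : ℕ, q.num = a := ⟨q.num.toNat, by
    rw [Int.toNat_of_nonneg (Rat.num_pos.mpr hqpos).le]⟩
  have hb := q.den_pos
  set b := q.den with hbdef
  have hqab : (q : ℝ) = a / b := by
    rw [Rat.cast_def, ha]; push_cast; rfl
  have hb' : (0 : ℝ) < b := by exact_mod_cast hb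
  rw [hqab, div_eq_div_iff hb'.ne' l2.ne'] at hq
  have h1 : ((1 + 2 / n : ℝ) ^ 2) ^ a = (2 + 2 / n) ^ b := by
    apply Real.log_injOn_pos (Set.mem_Ioi.mpr (by positivity)) (Set.mem_Ioi.mpr (by positivity))
    rw [Real.log_pow, Real.log_pow (n := b)]
    linarith
  have e1 : (1 + 2 / n : ℝ) = (n + 2) / n := by field_simp
  have e2 : (2 + 2 / n : ℝ) = (2 * (n + 1)) / n := by field_simp
  rw [e1, e2, ← pow_mul, div_pow, div_pow, div_eq_div_iff (by positivity) (by positivity)] at h1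
  have h2 : (n + 2) ^ (2 * a) * n ^ b = (2 * (n + 1)) ^ b * n ^ (2 * a) := by exact_mod_cast h1
  obtain ⟨p, hp, hpn⟩ := Nat.exists_prime_and_dvd (n := n + 1) (by omega)
  have h3 : p ∣ (n + 2) ^ (2 * a) * n ^ b := by
    rw [h2]
    exact Dvd.dvd.mul_right ((hpn.mul_left 2).trans (dvd_pow_self _ hb.ne')) _
  have h4 : p ∣ 1 := by
    rcases (hp.dvd_mul).mp h3 with h | h
    · exact (Nat.dvd_add_right hpn).mp (hp.dvd_of_dvd_pow h)
    · exact (Nat.dvd_add_right (hp.dvd_of_dvd_pow h)).mp hpn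
  exact hp.one_lt.ne' (Nat.dvd_one.mp h4)

lemma dense_of {L : Set ℝ} {a b : ℝ} (hb : 0 < b) (hab : Irrational (a / b)) (h0 : (0 : ℝ) ∈ L)
    (h1 : ∀ x ∈ L, x + a ∈ L) (h2 : ∀ x ∈ L, x + b ∈ L) (h3 : ∀ x, x + b ∈ L → x ∈ L) :
    Dense L := by
  have : Fact (0 < b) := ⟨hb⟩
  have hd : DenseRange (fun m : ℕ => m • (a : AddCircle b)) := by
    rw [← denseRange_zsmul_iff_nsmul]
    exact AddCircle.denseRange_zsmul_coe_iff.mpr hab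
  have hm : ∀ m : ℕ, m • a ∈ L := by
    intro m
    induction m with
    | zero => simpa using h0
    | succ k ih => rw [succ_nsmul]; exact h1 _ ih
  have hz : ∀ (k : ℕ) (x : ℝ), (x ∈ L → x + k • b ∈ L) ∧ (x + k • b ∈ L → x ∈ L) := by
    intro k
    induction k with
    | zero => intro x; simp
    | succ k ih =>
      intro x
      rw [succ_nsmul, ← add_assoc]
      exact ⟨fun h => h2 _ ((ih x).1 h), fun h => (ih x).2 (h3 _ h)⟩
  rw [dense_iff_inter_open]
  intro U hU ⟨x, hx⟩
  have hU' : IsOpen (Set.image (fun y : ℝ => (y : AddCircle b)) U) :=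
    QuotientAddGroup.isOpenMap_coe U hU
  obtain ⟨m, y, hy, hym⟩ := hd.exists_mem_open hU' ⟨_, x, hx, rfl⟩
  refine ⟨y, hy, ?_⟩
  have hym2 : ((y - m • a : ℝ) : AddCircle b) = 0 := by
    rw [AddCircle.coe_sub, sub_eq_zero]; exact hym
  obtain ⟨k, hk⟩ := AddCircle.coe_eq_zero_iff b |>.mp hym2
  have hma := hm m
  rcases Int.eq_nat_or_neg k with ⟨j, rfl | rfl⟩
  · have := (hz j _).1 hma
    rw [natCast_zsmul] at hk
    rw [hk, add_sub_cancel] at this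
    exact this
  · apply (hz j y).2
    rw [neg_smul, natCast_zsmul] at hk
    have : y + j • b = m • a := by linarith
    rw [this]; exact hma

end BQ

open BQ
theorem stmt_4 (n : ℕ) (hn : 2 ≤ n) (f : (Fin n → ℂ) → (Fin n → ℂ))
    (hcont : Continuous f)
    (hf : ∀ X Y : Fin n → ℂ, phi n X Y = 1 ^ 2 → phi n (f X) (f Y) = 1 ^ 2) :
    ∀ d : ℝ, 0 < d → ∀ X Y : Fin n → ℂ,
      phi n X Y = (d : ℂ) ^ 2 → phi n (f X) (f Y) = (d : ℂ) ^ 2 := by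
  have hphi : ∀ X Y, phi n X Y = (X - Y) ⬝ᵥ (X - Y) := by
    intro X Y
    simp [phi, dotProduct, pow_two]
  simp only [hphi] at hf ⊢
  have hf1 : Pres n f 1 := by
    intro X Y h
    simpa using hf X Y (by simpa using h)
  have hn0 : (0 : ℝ) < n := by exact_mod_cast (by omega : 0 < n)
  have hd0 : (0 : ℝ) < 2 / n := by positivity
  have hDp : (0 : ℝ) < 2 + 2 / n := by positivity
  have hLp : (0 : ℝ) < (1 + 2 / n) ^ 2 := by positivity
  have hD : Dense {x : ℝ | Pres n f ((Real.exp x : ℝ) : ℂ)} := by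
    refine dense_of (a := Real.log (2 + 2 / n)) (b := Real.log ((1 + 2 / n) ^ 2))
      (Real.log_pos (by nlinarith)) (irr hn) ?_ ?_ ?_ ?_
    · simpa using hf1
    · intro x hx
      have := scale (2 + 2 / (n : ℂ)) (fun g hg => presD hn hg) f _
        (by exact_mod_cast (Real.exp_pos x).ne') hx
      simp only [Set.mem_setOf_eq]
      rw [Real.exp_add, Real.exp_log hDp, mul_comm]
      push_cast
      push_cast at this
      exact this
    · intro x hx
      have := scale ((1 + 2 / (n : ℂ)) ^ 2) (fun g hg => presL hn hg) f _
        (by exact_mod_cast (Real.exp_pos x).ne') hx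
      simp only [Set.mem_setOf_eq]
      rw [Real.exp_add, Real.exp_log hLp, mul_comm]
      push_cast
      push_cast at this
      exact this
    · intro x hx
      simp only [Set.mem_setOf_eq] at hx ⊢
      rw [Real.exp_add, Real.exp_log hLp, mul_comm] at hx
      refine presDiv hn hf1 _ (by exact_mod_cast (Real.exp_pos x).ne') ?_
      push_cast
      push_cast at hx
      exact hx
  intro d hd X Y hXY
  have hdc : (d : ℂ) ≠ 0 := by exact_mod_cast hd.ne'
  let P : ℝ → Fin n → ℂ := fun y => Y + (((Real.exp (y / 2) / d : ℝ)) : ℂ) • (X - Y)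
  have hP : Continuous P := by
    dsimp only [P]
    fun_prop
  have hPd : ∀ y, (P y - Y) ⬝ᵥ (P y - Y) = ((Real.exp y : ℝ) : ℂ) := by
    intro y
    have : Real.exp y = Real.exp (y / 2) ^ 2 := by
      rw [← Real.exp_nat_mul]; congr 1; push_cast; ring
    rw [this]
    simp only [P]
    rw [add_sub_cancel_left, smul_dotProduct, dotProduct_smul, hXY]
    simp only [smul_eq_mul]
    push_cast
    field_simp
  have heq : (fun y : ℝ => (f (P y) - f Y) ⬝ᵥ (f (P y) - f Y)) =
      fun y : ℝ => ((Real.exp y : ℝ) : ℂ) := by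
    refine Continuous.ext_on hD ?_ ?_ ?_
    · have : Continuous fun y => f (P y) - f Y := (hcont.comp hP).sub continuous_const
      exact Continuous.dotProduct this this
    · fun_prop
    · intro y hy
      exact hy _ _ (hPd y)
  have h1 := congrFun heq (2 * Real.log d)
  have h2 : Real.exp (2 * Real.log d) = d ^ 2 := by
    rw [two_mul, Real.exp_add, Real.exp_log hd]; ring
  have h3 : P (2 * Real.log d) = X := by
    have : 2 * Real.log d / 2 = Real.log d := by ring
    simp only [P]
    rw [this, Real.exp_log hd, div_self hd.ne']
    simp
  simp only [h2, h3] at h1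
  rw [h1]; push_cast; rfl
end

section
/- If n ≥ 2, d ∈ ℂ \ {0}, and a continuous map f : ℂⁿ → ℂⁿ preserves distance d, then there exist an affine map I : ℂⁿ → ℂⁿ with orthogonal linear part and ρ ∈ {id_ℂ, τ_d} such that f = I ∘ (ρ,...,ρ), where τ_d : ℂ → ℂ is defined by τ_d(x) = (d/τ(d))·τ(x) and (ρ,...,ρ) acts coordinatewise. -/
section BQHelpers

open Matrix Filter Topology

lemma bq_householder {n : ℕ} (a b : Fin n → ℂ) (hab : a ⬝ᵥ a = b ⬝ᵥ b) (ha : a ⬝ᵥ a ≠ 0) :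
    ∃ U : (Fin n → ℂ) →ₗ[ℂ] (Fin n → ℂ), (∀ x y, U x ⬝ᵥ U y = x ⬝ᵥ y) ∧ U a = b := by
  have key : ∀ c : Fin n → ℂ, c ⬝ᵥ c ≠ 0 → ∃ R : (Fin n → ℂ) →ₗ[ℂ] (Fin n → ℂ),
      (∀ x y, R x ⬝ᵥ R y = x ⬝ᵥ y) ∧ ∀ x, R x = x - (2 * (c ⬝ᵥ x) / (c ⬝ᵥ c)) • c := by
    intro c hc
    refine ⟨{ toFun := fun x => x - (2 * (c ⬝ᵥ x) / (c ⬝ᵥ c)) • c, map_add' := ?_, map_smul' := ?_ }, ?_, fun x => rfl⟩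
    · intro x y
      ext i
      simp only [dotProduct_add, Pi.sub_apply, Pi.add_apply, Pi.smul_apply, smul_eq_mul]
      ring
    · intro m x
      ext i
      simp only [dotProduct_smul, Pi.sub_apply, Pi.smul_apply, smul_eq_mul, RingHom.id_apply]
      ring
    · intro x y
      simp only [LinearMap.coe_mk, AddHom.coe_mk, sub_dotProduct, dotProduct_sub, smul_dotProduct, dotProduct_smul, smul_eq_mul]
      rw [dotProduct_comm x c]
      field_simp
      ring
  have hba : b ⬝ᵥ a = a ⬝ᵥ b := dotProduct_comm b a
  by_cases h : (a - b) ⬝ᵥ (a - b) = 0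
  · have h' : (a + b) ⬝ᵥ (a + b) ≠ 0 := by
      simp only [sub_dotProduct, dotProduct_sub, add_dotProduct, dotProduct_add] at h ⊢
      intro h2
      apply ha
      linear_combination (1/4) * h + (1/4) * h2 + (1/2) * hab
    obtain ⟨R, hR, hR2⟩ := key _ h'
    refine ⟨-R, fun x y => by simp [hR], ?_⟩
    rw [LinearMap.neg_apply, hR2]
    have : 2 * ((a + b) ⬝ᵥ a) / ((a + b) ⬝ᵥ (a + b)) = 1 := by
      rw [div_eq_one_iff_eq h']
      simp only [add_dotProduct, dotProduct_add]
      linear_combination hab + hba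
    rw [this]; simp
  · obtain ⟨R, hR, hR2⟩ := key _ h
    refine ⟨R, hR, ?_⟩
    rw [hR2]
    have : 2 * ((a - b) ⬝ᵥ a) / ((a - b) ⬝ᵥ (a - b)) = 1 := by
      rw [div_eq_one_iff_eq h]
      simp only [sub_dotProduct, dotProduct_sub]
      linear_combination hab - hba
    rw [this]; simp

lemma bq_frame {n : ℕ} (a b : Fin n → (Fin n → ℂ)) (ha : ∀ w : Fin n → ℂ, (∀ i, a i ⬝ᵥ w = 0) → w = 0)
    (hab : ∀ i j, b i ⬝ᵥ b j = a i ⬝ᵥ a j) :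
    ∃ U : (Fin n → ℂ) →ₗ[ℂ] (Fin n → ℂ), (∀ x y, U x ⬝ᵥ U y = x ⬝ᵥ y) ∧ ∀ i, U (a i) = b i := by
  set M : Matrix (Fin n) (Fin n) ℂ := Matrix.of a with hM
  set N : Matrix (Fin n) (Fin n) ℂ := Matrix.of b with hN
  have hdet : M.det ≠ 0 := by
    intro h0
    obtain ⟨v, hv, hv2⟩ := Matrix.exists_mulVec_eq_zero_iff.mpr h0
    exact hv (ha v fun i => congrFun hv2 i)
  have hu : IsUnit M.det := isUnit_iff_ne_zero.mpr hdet
  have hgram : N * Nᵀ = M * Mᵀ := by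
    ext i j
    exact hab i j
  have h1 : M⁻¹ * M = 1 := Matrix.nonsing_inv_mul _ hu
  have h2 : Mᵀ * (M⁻¹)ᵀ = 1 := by rw [← Matrix.transpose_mul, h1, Matrix.transpose_one]
  have h3 : (M⁻¹)ᵀ * Mᵀ = 1 := by rw [← Matrix.transpose_mul, Matrix.mul_nonsing_inv _ hu, Matrix.transpose_one]
  have hA : (Nᵀ * (M⁻¹)ᵀ)ᵀ * (Nᵀ * (M⁻¹)ᵀ) = 1 := by
    rw [Matrix.transpose_mul, Matrix.transpose_transpose, Matrix.transpose_transpose,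
      Matrix.mul_assoc, ← Matrix.mul_assoc N, hgram, Matrix.mul_assoc M, h2, Matrix.mul_one, h1]
  refine ⟨Matrix.mulVecLin (Nᵀ * (M⁻¹)ᵀ), ?_, ?_⟩
  · intro x y
    rw [Matrix.mulVecLin_apply, Matrix.mulVecLin_apply, Matrix.dotProduct_mulVec, ← Matrix.mulVec_transpose,
      Matrix.mulVec_mulVec, hA, Matrix.one_mulVec]
  · intro i
    have e1 : a i = Mᵀ *ᵥ Pi.single i 1 := by
      ext k; simp [hM]
    rw [Matrix.mulVecLin_apply, e1, Matrix.mulVec_mulVec, Matrix.mul_assoc, h3, Matrix.mul_one]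
    ext k; simp [hN]

lemma bq_surj {n : ℕ} (U : (Fin n → ℂ) →ₗ[ℂ] (Fin n → ℂ)) (hU : ∀ x y, U x ⬝ᵥ U y = x ⬝ᵥ y) :
    Function.Surjective U := by
  rw [← LinearMap.injective_iff_surjective, injective_iff_map_eq_zero]
  intro x hx
  apply dotProduct_eq_zero
  intro w
  rw [← hU, hx, zero_dotProduct]

lemma bq_refl {n : ℕ} (p y : Fin n → (Fin n → ℂ)) (x x' X X' : Fin n → ℂ)
    (ha : ∀ w : Fin n → ℂ, (∀ i, (p i - x) ⬝ᵥ w = 0) → w = 0)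
    (hxx : ∀ i, (p i - x') ⬝ᵥ (p i - x') = (p i - x) ⬝ᵥ (p i - x))
    (hs : (x' - x) ⬝ᵥ (x' - x) ≠ 0)
    (h1 : ∀ i j, (y i - y j) ⬝ᵥ (y i - y j) = (p i - p j) ⬝ᵥ (p i - p j))
    (h2 : ∀ i, (y i - X) ⬝ᵥ (y i - X) = (p i - x) ⬝ᵥ (p i - x))
    (h3 : ∀ i, (y i - X') ⬝ᵥ (y i - X') = (p i - x') ⬝ᵥ (p i - x')) :
    ∃ U : (Fin n → ℂ) →ₗ[ℂ] (Fin n → ℂ), (∀ x y, U x ⬝ᵥ U y = x ⬝ᵥ y) ∧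
      (∀ i, y i - X = U (p i - x)) ∧ (X' = X ∨ X' - X = U (x' - x)) := by
  have pol : ∀ u v : Fin n → ℂ, u ⬝ᵥ v = (u ⬝ᵥ u + v ⬝ᵥ v - (u - v) ⬝ᵥ (u - v)) / 2 := by
    intro u v
    simp only [sub_dotProduct, dotProduct_sub]
    rw [dotProduct_comm v u]; ring
  obtain ⟨U, hU, hU2⟩ := bq_frame (fun i => p i - x) (fun i => y i - X) ha (by
    intro i j
    rw [pol, pol (p i - x), h2, h2, sub_sub_sub_cancel_right, sub_sub_sub_cancel_right, h1])
  refine ⟨U, hU, fun i => (hU2 i).symm, ?_⟩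
  obtain ⟨c, hc⟩ := bq_surj U hU (X' - X)
  set v := x' - x with hv
  have hv1 : ∀ i, v ⬝ᵥ v = 2 * ((p i - x) ⬝ᵥ v) := by
    intro i
    have := hxx i
    rw [show p i - x' = (p i - x) - v by rw [hv]; abel] at this
    rw [pol (p i - x) v, this]; ring
  have hc1 : ∀ i, c ⬝ᵥ c = 2 * ((p i - x) ⬝ᵥ c) := by
    intro i
    have := (h3 i).trans (hxx i)
    rw [show y i - X' = (y i - X) - (X' - X) by abel, ← hc, ← hU2 i, ← map_sub, hU] at this
    rw [pol (p i - x) c, this]; ring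
  by_cases hc0 : c ⬝ᵥ c = 0
  · left
    have : c = 0 := ha c fun i => by
      have := hc1 i; rw [hc0] at this; simpa using this.symm
    rw [this, map_zero] at hc
    exact (sub_eq_zero.mp hc.symm)
  · right
    have e : (v ⬝ᵥ v) • c - (c ⬝ᵥ c) • v = 0 := ha _ fun i => by
      rw [dotProduct_sub, dotProduct_smul, dotProduct_smul, smul_eq_mul, smul_eq_mul]
      linear_combination ((p i - x) ⬝ᵥ c) * hv1 i - ((p i - x) ⬝ᵥ v) * hc1 i
    have e1 : (v ⬝ᵥ v) • c = (c ⬝ᵥ c) • v := sub_eq_zero.mp e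
    have e2 : (v ⬝ᵥ v) * (v ⬝ᵥ c) = (c ⬝ᵥ c) * (v ⬝ᵥ v) := by
      have := congrArg (fun z => v ⬝ᵥ z) e1
      simpa [dotProduct_smul] using this
    have e3 : (v ⬝ᵥ v) * (c ⬝ᵥ c) = (c ⬝ᵥ c) * (v ⬝ᵥ c) := by
      have := congrArg (fun z => z ⬝ᵥ c) e1
      simpa [smul_dotProduct] using this
    have e4 : v ⬝ᵥ c = c ⬝ᵥ c := by
      apply mul_left_cancel₀ hs; rw [e2]; ring
    have e5 : v ⬝ᵥ v = c ⬝ᵥ c := by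
      apply mul_right_cancel₀ hc0; rw [e3, e4]
    rw [e5] at e1
    have : c = v := smul_right_injective _ hc0 e1
    rw [← hc, this]

def BQG (n : ℕ) (g : (Fin n → ℂ) → (Fin n → ℂ)) : Prop :=
  Continuous g ∧ ∀ x y : Fin n → ℂ, (x - y) ⬝ᵥ (x - y) = 1 → (g x - g y) ⬝ᵥ (g x - g y) = 1

def BQD (n : ℕ) (t : ℂ) : Prop :=
  ∀ g, BQG n g → ∀ x y : Fin n → ℂ, (x - y) ⬝ᵥ (x - y) = t → (g x - g y) ⬝ᵥ (g x - g y) = t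

lemma bq_one (n : ℕ) : BQD n 1 := fun _ hg => hg.2

lemma bq_lin_cont {n : ℕ} (U : (Fin n → ℂ) →ₗ[ℂ] (Fin n → ℂ)) : Continuous U :=
  LinearMap.continuous_of_finiteDimensional U

lemma bq_comp {n : ℕ} {g} (hg : BQG n g) (U : (Fin n → ℂ) →ₗ[ℂ] (Fin n → ℂ))
    (hU : ∀ x y, U x ⬝ᵥ U y = x ⬝ᵥ y) (m : Fin n → ℂ) : BQG n (fun w => g (m + U w)) := by
  refine ⟨hg.1.comp (continuous_const.add (bq_lin_cont U)), fun x y hxy => hg.2 _ _ ?_⟩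
  rw [add_sub_add_left_eq_sub, ← map_sub, hU, hxy]

lemma bq_scale {n : ℕ} {g} (hg : BQG n g) (c : ℂ) (hc : c ≠ 0) (hD : BQD n (c ^ 2)) :
    BQG n (fun w => c⁻¹ • g (c • w)) := by
  have := hg.1
  refine ⟨by fun_prop, fun x y hxy => ?_⟩
  have h := hD g hg (c • x) (c • y) (by
    rw [← smul_sub, smul_dotProduct, dotProduct_smul, hxy]; simp [sq])
  rw [← smul_sub, smul_dotProduct, dotProduct_smul, h]
  simp only [smul_eq_mul]
  field_simp

lemma bq_mul {n : ℕ} {s t : ℂ} (hs : BQD n s) (ht : BQD n t) (hs0 : s ≠ 0) : BQD n (s * t) := by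
  obtain ⟨c, hc⟩ := IsAlgClosed.exists_pow_nat_eq s (n := 2) (by norm_num)
  have hc0 : c ≠ 0 := by rintro rfl; apply hs0; rw [← hc]; norm_num
  intro g hg x y hxy
  have h := ht _ (bq_scale hg c hc0 (hc.symm ▸ hs)) (c⁻¹ • x) (c⁻¹ • y) (by
    rw [← smul_sub, smul_dotProduct, dotProduct_smul, hxy, ← hc]
    simp only [smul_eq_mul]; field_simp)
  simp only [smul_inv_smul₀ hc0] at h
  rw [← smul_sub, smul_dotProduct, dotProduct_smul] at h
  simp only [smul_eq_mul] at h
  rw [← h, ← hc]; field_simp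

lemma bq_pow {n : ℕ} {s : ℂ} (hs : BQD n s) (hs0 : s ≠ 0) (k : ℕ) : BQD n (s ^ k) := by
  induction k with
  | zero => simpa using bq_one n
  | succ k ih => rw [pow_succ']; exact bq_mul hs ih hs0

lemma bq_collapse {n : ℕ} (hn : 2 ≤ n) (s : ℂ) (hs : s ≠ 0)
    (h : ∀ g, BQG n g → ∀ x x' : Fin n → ℂ, (x' - x) ⬝ᵥ (x' - x) = s →
      g x' = g x ∨ (g x' - g x) ⬝ᵥ (g x' - g x) = s) : BQD n s := by
  intro g hg x y hxy
  by_contra hne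
  obtain ⟨c, hc⟩ := IsAlgClosed.exists_pow_nat_eq s (n := 2) (by norm_num)
  let i0 : Fin n := ⟨0, by omega⟩
  let i1 : Fin n := ⟨1, by omega⟩
  have h01 : i0 ≠ i1 := by simp [i0, i1]
  have ha : (Pi.single i0 c : Fin n → ℂ) ⬝ᵥ Pi.single i0 c = s := by simp [← hc, sq]
  have hb : (Pi.single i1 c : Fin n → ℂ) ⬝ᵥ Pi.single i1 c = s := by simp [← hc, sq]
  have hab : (Pi.single i0 c : Fin n → ℂ) ⬝ᵥ Pi.single i1 c = 0 := by simp [h01]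
  obtain ⟨U, hU, hUa⟩ := bq_householder _ (x - y) (ha.trans hxy.symm) (ha.symm ▸ hs)
  set w := U (Pi.single i1 c) with hw
  have hww : w ⬝ᵥ w = s := by rw [hw, hU, hb]
  have hvw : (x - y) ⬝ᵥ w = 0 := by rw [hw, ← hUa, hU, hab]
  have hwv : w ⬝ᵥ (x - y) = 0 := by rw [dotProduct_comm, hvw]
  set v := x - y with hv
  let γ : ℂ → (Fin n → ℂ) := fun θ => y + (Complex.cos θ • v + Complex.sin θ • w)
  have hγc : Continuous γ := by fun_prop
  have hγq : ∀ θ, (γ θ - y) ⬝ᵥ (γ θ - y) = s := by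
    intro θ
    simp only [γ, add_sub_cancel_left, add_dotProduct, dotProduct_add, smul_dotProduct, dotProduct_smul, smul_eq_mul, hww, hvw, hwv, hxy]
    linear_combination s * Complex.sin_sq_add_cos_sq θ
  have hd : ∀ θ, (g (γ θ) - g y) ⬝ᵥ (g (γ θ) - g y) ∈ ({0, s} : Set ℂ) := by
    intro θ
    rcases h g hg y (γ θ) (hγq θ) with h | h
    · left; simp [h]
    · right; simp [h]
  have hFc : Continuous fun θ => (g (γ θ) - g y) ⬝ᵥ (g (γ θ) - g y) := by
    have := hg.1
    fun_prop
  obtain ⟨z, hz, hz2⟩ := (isPreconnected_univ (α := ℂ)).eqOn_const_of_mapsTo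
    (Set.toFinite ({0, s} : Set ℂ)).isDiscrete hFc.continuousOn
    (fun θ _ => hd θ) ⟨0, by simp⟩
  have hγ0 : γ 0 = x := by simp [γ, hv]
  have hall : ∀ θ, g (γ θ) = g y := by
    intro θ
    rcases h g hg y (γ θ) (hγq θ) with h | h
    · exact h
    · exfalso
      apply hne
      have e1 := hz2 (Set.mem_univ θ)
      have e2 := hz2 (Set.mem_univ 0)
      simp only [Function.const_apply] at e1 e2
      rw [hγ0] at e2
      rw [e2, ← e1, h]
  obtain ⟨θ, hθ⟩ := Complex.cos_surjective (1 - 1 / (2 * s))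
  have h1 := hg.2 (γ θ) (γ 0) (by
    rw [show γ θ - γ 0 = (Complex.cos θ - 1) • v + Complex.sin θ • w by
      simp only [γ, Complex.cos_zero, Complex.sin_zero]; module]
    simp only [add_dotProduct, dotProduct_add, smul_dotProduct, dotProduct_smul, smul_eq_mul, hww, hvw, hwv, hxy]
    have := Complex.sin_sq_add_cos_sq θ
    have h3 : 2 * s * (1 - Complex.cos θ) = 1 := by rw [hθ]; field_simp; ring
    linear_combination s * this + h3)
  rw [hall, hall] at h1
  simp at h1

/-- the reflection principle -/
lemma bq_reflD {n : ℕ} (hn : 2 ≤ n) (p : Fin n → (Fin n → ℂ)) (x x' : Fin n → ℂ)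
    (ha : ∀ w : Fin n → ℂ, (∀ i, (p i - x) ⬝ᵥ w = 0) → w = 0)
    (hxx : ∀ i, (p i - x') ⬝ᵥ (p i - x') = (p i - x) ⬝ᵥ (p i - x))
    (hs : (x' - x) ⬝ᵥ (x' - x) ≠ 0)
    (h1 : ∀ i j, i ≠ j → BQD n ((p i - p j) ⬝ᵥ (p i - p j)))
    (h2 : ∀ i, BQD n ((p i - x) ⬝ᵥ (p i - x))) :
    BQD n ((x' - x) ⬝ᵥ (x' - x)) ∧ ∀ g, BQG n g → 
      ∃ U : (Fin n → ℂ) →ₗ[ℂ] (Fin n → ℂ), (∀ x y, U x ⬝ᵥ U y = x ⬝ᵥ y) ∧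
      (∀ i, g (p i) - g x = U (p i - x)) ∧ g x' - g x = U (x' - x) := by
  have main : ∀ g, BQG n g → 
      ∃ U : (Fin n → ℂ) →ₗ[ℂ] (Fin n → ℂ), (∀ x y, U x ⬝ᵥ U y = x ⬝ᵥ y) ∧
      (∀ i, g (p i) - g x = U (p i - x)) ∧ (g x' = g x ∨ g x' - g x = U (x' - x)) := by
    intro g hg
    refine bq_refl p (fun i => g (p i)) x x' (g x) (g x') ha hxx hs ?_ ?_ ?_
    · intro i j
      by_cases hij : i = j
      · simp [hij]
      · exact h1 i j hij g hg _ _ rfl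
    · intro i
      exact h2 i g hg _ _ rfl
    · intro i
      rw [hxx]
      exact h2 i g hg _ _ (hxx i)
  have hD : BQD n ((x' - x) ⬝ᵥ (x' - x)) := by
    refine bq_collapse hn _ hs fun g hg z z' hz => ?_
    obtain ⟨U, hU, hUa⟩ := bq_householder _ (z' - z) hz.symm hs
    obtain ⟨A, hA, -, h⟩ := main _ (bq_comp hg U hU (z - U x))
    have e1 : z - U x + U x = z := by abel
    have e2 : z - U x + U x' = z' := by 
      rw [map_sub] at hUa
      rw [sub_add, ← neg_sub (U x'), hUa]; abel
    simp only [e1, e2] at h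
    rcases h with h | h
    · exact Or.inl h
    · right; rw [h, hA]
  refine ⟨hD, fun g hg => ?_⟩
  obtain ⟨U, hU, hU2, h⟩ := main g hg
  refine ⟨U, hU, hU2, h.resolve_left fun h => ?_⟩
  have := hD g hg x' x rfl
  rw [h] at this
  apply hs; rw [← this]; simp

noncomputable def bqp (n : ℕ) (r : ℂ) (i : Fin n) : Fin n → ℂ := Pi.single i r - fun _ => r / n

lemma bq_dotc (n : ℕ) (i : Fin n) (r a : ℂ) (w : Fin n → ℂ) :
    ((Pi.single i r : Fin n → ℂ) - fun _ => a) ⬝ᵥ w = r * w i - a * ∑ j, w j := by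
  rw [sub_dotProduct, single_dotProduct]
  simp [dotProduct, Finset.mul_sum]

lemma bq_P {n : ℕ} (hn : 2 ≤ n) (r h : ℂ) (hr : r ≠ 0) (hh : h ≠ 0) (h1 : BQD n (2 * r ^ 2))
    (h2 : BQD n (r ^ 2 - r ^ 2 / n + n * h ^ 2)) :
    BQD n (4 * n * h ^ 2) ∧ ∀ g, BQG n g →
      g (fun _ => h) + g (fun _ => -h) = (2 / (n : ℂ)) • ∑ i, g (bqp n r i) := by
  have hn0 : (n : ℂ) ≠ 0 := by exact_mod_cast (by omega : n ≠ 0)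
  have px : ∀ h : ℂ, ∀ i, bqp n r i - (fun _ => h) = Pi.single i r - fun _ => (r / n + h) := by
    intro h i; ext k; simp [bqp]; ring
  have qpx : ∀ h : ℂ, ∀ i, (bqp n r i - (fun _ => h)) ⬝ᵥ (bqp n r i - (fun _ => h)) = r ^ 2 - r ^ 2 / n + n * h ^ 2 := by
    intro h i
    rw [px, bq_dotc]
    simp [Finset.sum_sub_distrib]
    field_simp
    ring
  have qpp : ∀ i j, i ≠ j → (bqp n r i - bqp n r j) ⬝ᵥ (bqp n r i - bqp n r j) = 2 * r ^ 2 := by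
    intro i j hij
    rw [show bqp n r i - bqp n r j = Pi.single i r - Pi.single j r by simp [bqp]]
    simp [dotProduct_sub, hij, hij.symm]
    ring
  have qxx : ((fun _ => -h : Fin n → ℂ) - fun _ => h) ⬝ᵥ ((fun _ => -h : Fin n → ℂ) - fun _ => h) = 4 * n * h ^ 2 := by
    simp [dotProduct]; ring
  have key := bq_reflD hn (bqp n r) (fun _ => h) (fun _ => -h) ?_ ?_ ?_ ?_ ?_
  · rw [qxx] at key
    refine ⟨key.1, fun g hg => ?_⟩
    obtain ⟨U, -, hU1, hU2⟩ := key.2 g hg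
    have hsum : ∑ i, (g (bqp n r i) - g (fun _ => h)) = U (∑ i, (bqp n r i - fun _ => h)) := by
      rw [map_sum]; exact Finset.sum_congr rfl fun i _ => hU1 i
    have hs0 : ∑ i, (bqp n r i - fun _ => h) = (-(n : ℂ)) • (fun _ => h : Fin n → ℂ) := by
      ext k
      simp [bqp, Finset.sum_apply, Finset.sum_sub_distrib, Pi.single_apply]
      field_simp
      ring
    have hx : ((fun _ => -h : Fin n → ℂ) - fun _ => h) = (-2 : ℂ) • (fun _ => h : Fin n → ℂ) := by
      ext k; simp; ring
    rw [hx, map_smul] at hU2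
    rw [hs0, map_smul, Finset.sum_sub_distrib, Finset.sum_const, Finset.card_univ, Fintype.card_fin] at hsum
    ext k
    have e1 := congrFun hsum k
    have e2 := congrFun hU2 k
    simp only [Pi.sub_apply, Pi.smul_apply, Pi.add_apply, smul_eq_mul, nsmul_eq_mul] at e1 e2 ⊢
    simp only [Pi.mul_apply, Pi.natCast_apply] at e1
    field_simp
    linear_combination (n : ℂ) * e2 - 2 * e1
  · intro w hw
    have hw' : ∀ i, r * w i - (r / n + h) * ∑ j, w j = 0 := fun i => by
      rw [← bq_dotc, ← px]; exact hw i
    have hS : ∑ j, w j = 0 := by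
      have : ∑ i, (r * w i - (r / n + h) * ∑ j, w j) = 0 := Finset.sum_eq_zero fun i _ => hw' i
      rw [Finset.sum_sub_distrib, ← Finset.mul_sum] at this
      simp only [Finset.sum_const, Finset.card_univ, Fintype.card_fin, nsmul_eq_mul] at this
      have h3 : (n * h) * ∑ j, w j = 0 := by
        field_simp at this
        linear_combination -this
      exact (mul_eq_zero.mp h3).resolve_left (mul_ne_zero hn0 hh)
    ext i
    have := hw' i
    rw [hS] at this
    simpa [hr] using this
  · intro i; rw [qpx, qpx]; ring
  · rw [qxx]; simp [hh]; omega
  · intro i j hij; rw [qpp i j hij]; exact h1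
  · intro i; rw [qpx]; exact h2

lemma bq_P2 {n : ℕ} (hn : 2 ≤ n) (s t : ℂ) (hs : BQD n s) (ht : BQD n t) (ht0 : t ≠ 0) (v : ℂ)
    (hv : v = 4 * s - 2 * t * (n - 1) / n) (hv0 : v ≠ 0) : BQD n v := by
  have hn0 : (n : ℂ) ≠ 0 := by exact_mod_cast (by omega : n ≠ 0)
  obtain ⟨r, hr⟩ := IsAlgClosed.exists_pow_nat_eq (t / 2) (n := 2) (by norm_num)
  obtain ⟨h, hh⟩ := IsAlgClosed.exists_pow_nat_eq (v / (4 * n)) (n := 2) (by norm_num)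
  have hr0 : r ≠ 0 := by rintro rfl; apply ht0; simpa using hr.symm
  have hh0 : h ≠ 0 := by rintro rfl; apply hv0; simpa [hn0] using hh.symm
  have := (bq_P hn r h hr0 hh0 ?_ ?_).1
  · rw [hh] at this
    convert this using 1; field_simp
  · rw [hr]; convert ht using 1; ring
  · rw [hr, hh, hv]; convert hs using 1; field_simp; ring

lemma bq_tri (h1 : BQD 2 1) (h3 : BQD 2 3) : BQD 2 (11 / 3) := by
  obtain ⟨c, hc⟩ := IsAlgClosed.exists_pow_nat_eq (3 : ℂ) (n := 2) (by norm_num)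
  obtain ⟨b, hb⟩ := IsAlgClosed.exists_pow_nat_eq (11 / 12 : ℂ) (n := 2) (by norm_num)
  have hc0 : c ≠ 0 := by rintro rfl; norm_num at hc
  have hb0 : b ≠ 0 := by rintro rfl; norm_num at hb
  have := (bq_reflD le_rfl ![![0, 0], ![c, 0]] ![c / 6, b] ![c / 6, -b] ?_ ?_ ?_ ?_ ?_).1
  · convert this using 1
    simp
    linear_combination (-4) * hb
  · intro w hw
    have e0 := hw 0
    have e1 := hw 1
    simp [vecHead, vecTail] at e0 e1
    have w0 : w 0 = 0 := by
      have : c * w 0 = 0 := by linear_combination e1 - e0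
      simpa [hc0] using this
    have w1 : w 1 = 0 := by
      rw [w0] at e0; simpa [hb0] using e0
    ext i; fin_cases i <;> simp [w0, w1]
  · intro i; fin_cases i <;> simp
  · simp
    intro h
    apply hb0
    linear_combination (-1/2) * h
  · have e : BQD 2 (c * c) := by rw [← sq, hc]; exact h3
    intro i j hij
    fin_cases i <;> fin_cases j <;> simp at hij ⊢ <;> exact e
  · intro i; fin_cases i
    · convert h1 using 1
      simp
      linear_combination (1/36) * hc + hb
    · convert h3 using 1
      simp
      linear_combination (25/36) * hc + hb

lemma bq_contr {n : ℕ} (hn : 2 ≤ n) : ∃ ε : ℝ, 0 < ε ∧ ε < 1 ∧ BQD n (ε : ℂ) := by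
  have hn0 : (n : ℂ) ≠ 0 := by exact_mod_cast (by omega : n ≠ 0)
  have hn1 : (n : ℂ) + 1 ≠ 0 := by exact_mod_cast (by omega : n + 1 ≠ 0)
  have hα : BQD n (2 * (n + 1) / n) := by
    refine bq_P2 hn 1 1 (bq_one n) (bq_one n) one_ne_zero _ ?_ ?_
    · field_simp; ring
    · simp [hn0, hn1]
  rcases hn.eq_or_lt with rfl | hn3
  · refine ⟨1/3, by norm_num, by norm_num, ?_⟩
    have h3 : BQD 2 3 := by convert hα using 1; norm_num
    refine bq_P2 le_rfl 1 (11/3) (bq_one 2) (bq_tri (bq_one 2) h3) (by norm_num) _ ?_ ?_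
    · push_cast; norm_num
    · push_cast; norm_num
  · refine ⟨4 / n ^ 2, by positivity, ?_, ?_⟩
    · have : (3 : ℝ) ≤ n := by exact_mod_cast hn3
      rw [div_lt_one (by positivity)]
      nlinarith
    · refine bq_P2 hn 1 _ (bq_one n) hα ?_ _ ?_ ?_
      · simp [hn0, hn1]
      · push_cast; field_simp; ring
      · push_cast; simp [hn0]

lemma bq_affine_real {n : ℕ} (F : ℝ → (Fin n → ℂ)) (hF : Continuous F) (δ : ℕ → ℝ) (hδ : ∀ k, 0 < δ k)
    (hδ0 : Tendsto δ atTop (𝓝 0)) (hJ : ∀ k t, F (t + δ k) + F (t - δ k) = (2 : ℝ) • F t) (r : ℝ) :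
    F r = F 0 + r • (F 1 - F 0) := by
  have hnat : ∀ k t, ∀ m : ℕ, F (t + m * δ k) = F t + (m : ℝ) • (F (t + δ k) - F t) := by
    intro k t m
    induction m using Nat.strong_induction_on with
    | _ m ih =>
      match m with
      | 0 => simp
      | 1 => simp
      | m + 2 =>
        have h1 := ih (m + 1) (by omega)
        have h2 := ih m (by omega)
        have h3 := hJ k (t + (m + 1 : ℕ) * δ k)
        rw [show t + (m + 1 : ℕ) * δ k + δ k = t + (m + 2 : ℕ) * δ k by push_cast; ring,
          show t + (m + 1 : ℕ) * δ k - δ k = t + m * δ k by push_cast; ring, h1, h2] at h3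
        rw [eq_sub_of_add_eq h3]
        push_cast
        module
  have hzfl : ∀ k, ∀ m : ℤ, F (m * δ k) = F 0 + ((m : ℝ) * δ k) • ((δ k)⁻¹ • (F (δ k) - F 0)) := by
    intro k m
    rw [smul_smul, mul_assoc, mul_inv_cancel₀ (hδ k).ne', mul_one]
    obtain ⟨a, rfl | rfl⟩ := m.eq_nat_or_neg
    · have := hnat k 0 a
      simpa using this
    · have h1 := hnat k (-(a * δ k)) a
      have h2 := hnat k (-(a * δ k)) (a + 1)
      rw [neg_add_cancel] at h1
      rw [show -(a * δ k) + (a + 1 : ℕ) * δ k = δ k by push_cast; ring] at h2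
      push_cast at h2 ⊢
      rw [neg_mul, h2]
      rw [h1]
      module
  have hfl : ∀ r : ℝ, Tendsto (fun k => (⌊r / δ k⌋ : ℝ) * δ k) atTop (𝓝 r) := by
    intro r
    have h0 : Tendsto (fun k => r - δ k) atTop (𝓝 r) := by
      simpa using tendsto_const_nhds.sub hδ0
    refine tendsto_of_tendsto_of_tendsto_of_le_of_le h0 tendsto_const_nhds ?_ ?_
    · intro k
      have := Int.lt_floor_add_one (r / δ k)
      rw [div_lt_iff₀ (hδ k)] at this
      simp only
      linarith
    · intro k
      have := Int.floor_le (r / δ k)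
      rw [le_div_iff₀ (hδ k)] at this
      exact this
  have hlim : ∀ r : ℝ, Tendsto (fun k => ((⌊r / δ k⌋ : ℝ) * δ k) • ((δ k)⁻¹ • (F (δ k) - F 0))) atTop (𝓝 (F r - F 0)) := by
    intro r
    have h1 : Tendsto (fun k => F ((⌊r / δ k⌋ : ℝ) * δ k) - F 0) atTop (𝓝 (F r - F 0)) :=
      ((hF.tendsto r).comp (hfl r)).sub_const _
    refine h1.congr fun k => ?_
    rw [hzfl k]; simp
  have hone : Tendsto (fun k => (δ k)⁻¹ • (F (δ k) - F 0)) atTop (𝓝 (F 1 - F 0)) := by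
    have h1 := ((hfl 1).inv₀ one_ne_zero).smul (hlim 1)
    rw [inv_one, one_smul] at h1
    refine h1.congr' ?_
    have : ∀ᶠ k in atTop, (⌊1 / δ k⌋ : ℝ) * δ k ≠ 0 := (hfl 1).eventually_ne one_ne_zero
    filter_upwards [this] with k hk
    rw [inv_smul_smul₀ hk]
  have := tendsto_nhds_unique (hlim r) ((hfl r).smul hone)
  rw [← this]; abel

lemma bq_seq (ε : ℝ) (h0 : 0 < ε) (h1 : ε < 1) : Tendsto (fun k : ℕ => √(ε ^ k)) atTop (𝓝 0) := by
  have := (Real.continuous_sqrt.tendsto 0).comp (tendsto_pow_atTop_nhds_zero_of_lt_one h0.le h1)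
  rw [Real.sqrt_zero] at this
  exact this

lemma bq_jensen {n : ℕ} (hn : 2 ≤ n) {g} (hg : BQG n g) (m u : Fin n → ℂ) (hu : u ⬝ᵥ u = 1) :
    g (m + u) + g (m - u) = (2 : ℝ) • g m := by
  have hn0 : (n : ℂ) ≠ 0 := by exact_mod_cast (by omega : n ≠ 0)
  have hn0' : (0 : ℝ) < n := by exact_mod_cast (by omega : 0 < n)
  obtain ⟨ε, hε0, hε1, hε⟩ := bq_contr hn
  let H : ℝ → ℝ := fun r => √((1 - r ^ 2 * (1 - 1 / n)) / n)
  have hHc : Continuous H := by fun_prop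
  have hH2 : ∀ r : ℝ, r ^ 2 ≤ 1 / 2 → 0 < (1 - r ^ 2 * (1 - 1 / n)) / n := by
    intro r hr
    apply div_pos _ hn0'
    have : (0 : ℝ) < 1 / n := by positivity
    nlinarith [sq_nonneg r]
  have hq : (fun _ => ((H 0 : ℝ) : ℂ) : Fin n → ℂ) ⬝ᵥ (fun _ => ((H 0 : ℝ) : ℂ)) = 1 := by
    have : H 0 * H 0 = 1 / n := by
      simp only [H]
      rw [Real.mul_self_sqrt (hH2 0 (by norm_num)).le]; simp
    simp only [dotProduct, Finset.sum_const, Finset.card_univ, Fintype.card_fin, nsmul_eq_mul]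
    rw [← Complex.ofReal_mul, this]
    push_cast
    field_simp
  obtain ⟨U, hU, hUu⟩ := bq_householder _ u (hq.trans hu.symm) (by rw [hq]; exact one_ne_zero)
  have hg' := bq_comp hg U hU m
  set g' := fun w => g (m + U w) with hg'd
  have hgc := hg'.1
  let r : ℕ → ℝ := fun k => √(ε ^ k) * √(1 / 2)
  have hr0 : Tendsto r atTop (𝓝 0) := by
    have := (bq_seq ε hε0 hε1).mul_const (√(1 / 2))
    rw [zero_mul] at this
    exact this
  have hr2 : ∀ k, r k ^ 2 = ε ^ k / 2 := by
    intro k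
    simp only [r]
    rw [mul_pow, Real.sq_sqrt (by positivity), Real.sq_sqrt (by positivity)]; ring
  have hid : ∀ k, g' (fun _ => (H (r k) : ℂ)) + g' (fun _ => -(H (r k) : ℂ)) =
      (2 / (n : ℂ)) • ∑ i, g' (bqp n (r k : ℂ) i) := by
    intro k
    have hle : r k ^ 2 ≤ 1 / 2 := by
      rw [hr2]
      have := pow_le_one₀ (n := k) hε0.le hε1.le
      linarith
    have hHk : H (r k) ^ 2 = (1 - r k ^ 2 * (1 - 1 / n)) / n := Real.sq_sqrt (hH2 _ hle).le
    refine (bq_P hn (r k) (H (r k)) ?_ ?_ ?_ ?_).2 g' hg'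
    · have : 0 < r k := by positivity
      exact_mod_cast this.ne'
    · have : 0 < H (r k) := Real.sqrt_pos.mpr (hH2 _ hle)
      exact_mod_cast this.ne'
    · rw [← Complex.ofReal_pow, hr2]
      convert bq_pow hε (by exact_mod_cast hε0.ne') k using 1
      push_cast; ring
    · rw [← Complex.ofReal_pow (H _), hHk]
      convert bq_one n using 1
      push_cast
      field_simp
      ring
  have hpc : ∀ i, Continuous fun t : ℝ => bqp n (t : ℂ) i := by
    intro i
    refine continuous_pi fun j => ?_
    simp only [bqp, Pi.sub_apply, Pi.single_apply]
    split_ifs <;> fun_prop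
  have hL : Continuous fun t : ℝ => g' (fun _ => (H t : ℂ)) + g' (fun _ => -(H t : ℂ)) := by
    fun_prop
  have hR : Continuous fun t : ℝ => (2 / (n : ℂ)) • ∑ i, g' (bqp n (t : ℂ) i) := by
    have : Continuous fun t : ℝ => ∑ i, g' (bqp n (t : ℂ) i) :=
      continuous_finsetSum _ fun i _ => hgc.comp (hpc i)
    fun_prop
  have h1 := (hL.tendsto 0).comp hr0
  have h2 := (hR.tendsto 0).comp hr0
  have h3 := tendsto_nhds_unique (h1.congr hid) h2
  have hz : ∀ i, bqp n ((0 : ℝ) : ℂ) i = 0 := by intro i; simp [bqp]; rfl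
  simp only [hz] at h3
  have hneg : (fun _ => -((H 0 : ℝ) : ℂ) : Fin n → ℂ) = -(fun _ => ((H 0 : ℝ) : ℂ)) := rfl
  rw [hneg] at h3
  simp only [hg'd, map_neg, hUu, map_zero, add_zero, Finset.sum_const, Finset.card_univ, Fintype.card_fin] at h3
  rw [sub_eq_add_neg, h3]
  ext k
  simp
  field_simp

lemma bq_line {n : ℕ} (hn : 2 ≤ n) {g} (hg : BQG n g) (x u : Fin n → ℂ) (hu : u ⬝ᵥ u = 1) (r : ℝ) :
    g (x + r • u) = g x + r • (g (x + u) - g x) := by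
  obtain ⟨ε, hε0, hε1, hε⟩ := bq_contr hn
  have hgc := hg.1
  have := bq_affine_real (fun t => g (x + t • u)) (by fun_prop) (fun k => √(ε ^ k))
    (fun k => by positivity) (bq_seq ε hε0 hε1) ?_ r
  · simpa using this
  · intro k t
    have hc0 : ((√(ε ^ k) : ℝ) : ℂ) ≠ 0 := by
      have : 0 < √(ε ^ k) := by positivity
      exact_mod_cast this.ne'
    have hs := bq_scale hg ((√(ε ^ k) : ℝ) : ℂ) hc0 (by
      rw [← Complex.ofReal_pow, Real.sq_sqrt (by positivity)]
      push_cast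
      exact bq_pow hε (by exact_mod_cast hε0.ne') k)
    set c := ((√(ε ^ k) : ℝ) : ℂ) with hc
    have hj := bq_jensen hn hs (c⁻¹ • (x + t • u)) u hu
    simp only [smul_add, smul_sub, smul_inv_smul₀ hc0] at hj
    have hcu : c • u = √(ε ^ k) • u := by rw [hc]; ext i; simp
    have e1 : c • c⁻¹ • x + c • c⁻¹ • t • u + c • u = x + (t + √(ε ^ k)) • u := by
      rw [smul_inv_smul₀ hc0, smul_inv_smul₀ hc0, hcu]; module
    have e2 : c • c⁻¹ • x + c • c⁻¹ • t • u - c • u = x + (t - √(ε ^ k)) • u := by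
      rw [smul_inv_smul₀ hc0, smul_inv_smul₀ hc0, hcu]; module
    simp only [smul_inv_smul₀ hc0, hcu] at hj e1 e2
    rw [e1, e2, ← smul_add, smul_comm (2 : ℝ)] at hj
    exact smul_right_injective _ (inv_ne_zero hc0) hj

lemma bq_trans {n : ℕ} (hn : 2 ≤ n) {g} (hg : BQG n g) (x u v : Fin n → ℂ) (hu : u ⬝ᵥ u = 1)
    (huv : u ⬝ᵥ v = 0) (σ : ℝ) (hv : v ⬝ᵥ v = σ) : g (x + v + u) - g (x + v) = g (x + u) - g x := by
  have hvu : v ⬝ᵥ u = 0 := by rw [dotProduct_comm, huv]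
  have hgc := hg.1
  let w : ℝ → ℝ := fun t => √(1 + σ * t ^ 2)
  have hwc : Continuous w := by fun_prop
  have hw0 : w 0 = 1 := by simp [w]
  let uu : ℝ → (Fin n → ℂ) := fun t => (w t)⁻¹ • (u + t • v)
  have huu0 : uu 0 = u := by simp [uu, hw0]
  have huc : ContinuousAt uu 0 := by
    have h1 : ContinuousAt (fun t => (w t)⁻¹) 0 :=
      hwc.continuousAt.inv₀ (by rw [hw0]; exact one_ne_zero)
    have h2 : ContinuousAt (fun t : ℝ => u + t • v) 0 := by fun_prop
    exact h1.smul h2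
  have hL : Tendsto (fun t => t • g x + w t • (g (x + uu t) - g x)) (𝓝[>] 0)
      (𝓝 ((0 : ℝ) • g x + w 0 • (g (x + uu 0) - g x))) := by
    refine Tendsto.mono_left ?_ nhdsWithin_le_nhds
    have h1 : ContinuousAt (fun t => g (x + uu t)) 0 :=
      hgc.continuousAt.comp (f := fun t => x + uu t) (continuousAt_const.add huc)
    exact (continuousAt_id.smul continuousAt_const).add (hwc.continuousAt.smul (h1.sub continuousAt_const))
  have hR : Tendsto (fun t : ℝ => t • g (x + v) + (g (x + v + u) - g (x + v))) (𝓝[>] 0)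
      (𝓝 ((0 : ℝ) • g (x + v) + (g (x + v + u) - g (x + v)))) := by
    refine Tendsto.mono_left ?_ nhdsWithin_le_nhds
    exact Continuous.tendsto (f := fun t : ℝ => t • g (x + v) + (g (x + v + u) - g (x + v))) (by fun_prop) 0
  have hpos : ∀ᶠ t in 𝓝[>] (0 : ℝ), 0 < 1 + σ * t ^ 2 := by
    apply Filter.Eventually.filter_mono nhdsWithin_le_nhds
    have : Continuous fun t : ℝ => 1 + σ * t ^ 2 := by fun_prop
    exact this.continuousAt.eventually (lt_mem_nhds (by simp))
  have heq : (fun t => t • g x + w t • (g (x + uu t) - g x)) =ᶠ[𝓝[>] 0]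
      (fun t : ℝ => t • g (x + v) + (g (x + v + u) - g (x + v))) := by
    filter_upwards [hpos, self_mem_nhdsWithin] with t ht ht0
    have ht0 : t ≠ 0 := (Set.mem_Ioi.mp ht0).ne'
    have hw : 0 < w t := Real.sqrt_pos.mpr ht
    have hw2 : w t ^ 2 = 1 + σ * t ^ 2 := Real.sq_sqrt ht.le
    have hq : uu t ⬝ᵥ uu t = 1 := by
      simp only [uu, smul_dotProduct, dotProduct_smul, add_dotProduct, dotProduct_add, hu, huv, hvu, hv]
      simp only [Complex.real_smul]
      have hw2' : ((w t : ℝ) : ℂ) ^ 2 = 1 + σ * t ^ 2 := by exact_mod_cast hw2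
      have : ((w t : ℝ) : ℂ) ≠ 0 := by exact_mod_cast hw.ne'
      push_cast
      field_simp
      rw [hw2']; ring
    have l1 := bq_line hn hg x (uu t) hq (t⁻¹ * w t)
    have l2 := bq_line hn hg (x + v) u hu t⁻¹
    have e : x + (t⁻¹ * w t) • uu t = x + v + t⁻¹ • u := by
      simp only [uu]
      rw [smul_smul, mul_assoc, mul_inv_cancel₀ hw.ne', mul_one, smul_add, inv_smul_smul₀ ht0]; abel
    rw [e, l2] at l1
    have := congrArg (fun z => t • z) l1
    simp only [smul_add, smul_inv_smul₀ ht0, mul_smul] at this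
    exact this.symm
  have := tendsto_nhds_unique (hL.congr' heq) hR
  rw [hw0, huu0] at this
  simpa using this.symm

lemma bq_on {n : ℕ} (b : Fin n → (Fin n → ℂ)) (h1 : ∀ i, b i ⬝ᵥ b i = 1) (h2 : ∀ i j, i ≠ j → b i ⬝ᵥ b j = 0) :
    ∃ U : (Fin n → ℂ) →ₗ[ℂ] (Fin n → ℂ), (∀ x y, U x ⬝ᵥ U y = x ⬝ᵥ y) ∧ ∀ i, U (Pi.single i 1) = b i := by
  apply bq_frame (fun i => Pi.single i 1) b
  · intro w hw
    ext i
    simpa using hw i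
  · intro i j
    by_cases h : i = j
    · subst h; simp [h1]
    · simp [h2 i j h, h]

lemma bq_expand {n : ℕ} (b : Fin n → (Fin n → ℂ)) (h1 : ∀ i, b i ⬝ᵥ b i = 1) (h2 : ∀ i j, i ≠ j → b i ⬝ᵥ b j = 0)
    (z : Fin n → ℂ) (j : Fin n) (hz : ∀ k, k ≠ j → z ⬝ᵥ b k = 0) : z = (z ⬝ᵥ b j) • b j := by
  obtain ⟨U, hU, hb⟩ := bq_on b h1 h2
  obtain ⟨c, rfl⟩ := bq_surj U hU z
  have hc : ∀ k, U c ⬝ᵥ b k = c k := by intro k; rw [← hb, hU]; simp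
  rw [hc, ← hb, ← map_smul]
  congr 1
  ext k
  by_cases h : k = j
  · subst h; simp
  · rw [← hc, hz k h]; simp [h]

lemma bq_orth {n : ℕ} (hn : 2 ≤ n) {g} (hg : BQG n g) (x : Fin n → ℂ) (j k : Fin n) (hjk : j ≠ k) :
    (g (x + Pi.single j 1) - g x) ⬝ᵥ (g (x + Pi.single k 1) - g x) = 0 := by
  have h1 : ∀ i, (g (x + Pi.single i 1) - g x) ⬝ᵥ (g (x + Pi.single i 1) - g x) = 1 := by
    intro i
    apply hg.2
    simp
  have h2 : (g (x + Pi.single j 1) - g (x + Pi.single k 1)) ⬝ᵥ (g (x + Pi.single j 1) - g (x + Pi.single k 1)) = 2 := by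
    have s2 : (0 : ℝ) < √2 := by positivity
    have s2' : (((√2 : ℝ)) : ℂ) ≠ 0 := by exact_mod_cast s2.ne'
    have s2'' : (((√2 : ℝ)) : ℂ) ^ 2 = 2 := by exact_mod_cast Real.sq_sqrt (by norm_num : (0 : ℝ) ≤ 2)
    set u : Fin n → ℂ := (√2)⁻¹ • (Pi.single j 1 - Pi.single k 1) with hu
    have hq : u ⬝ᵥ u = 1 := by
      rw [hu, smul_dotProduct, dotProduct_smul]
      simp [dotProduct_sub, hjk, hjk.symm]
      field_simp
      rw [s2'']; norm_num
    have l := bq_line hn hg (x + Pi.single k 1) u hq √2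
    have e : x + Pi.single k 1 + √2 • u = x + Pi.single j 1 := by
      rw [hu, smul_inv_smul₀ s2.ne']; abel
    rw [e] at l
    rw [l, add_sub_cancel_left, smul_dotProduct, dotProduct_smul, hg.2 _ _ (by simpa using hq)]
    simp only [Complex.real_smul, mul_one]
    rw [← sq, s2'']
  rw [← sub_sub_sub_cancel_right _ _ (g x)] at h2
  have ha := h1 j
  have hb := h1 k
  set A := g (x + Pi.single j 1) - g x
  set B := g (x + Pi.single k 1) - g x
  have h3 : (A - B) ⬝ᵥ (A - B) = A ⬝ᵥ A - 2 * (A ⬝ᵥ B) + B ⬝ᵥ B := by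
    clear_value A B
    rw [sub_dotProduct, dotProduct_sub, dotProduct_sub, dotProduct_comm B A]; ring
  rw [h3] at h2
  linear_combination (1/2) * ha + (1/2) * hb - (1/2) * h2

lemma bq_const_e {n : ℕ} (hn : 2 ≤ n) {g} (hg : BQG n g) (k : Fin n) (x : Fin n → ℂ) :
    g (x + Pi.single k 1) - g x = g (Pi.single k 1) - g 0 := by
  have hgc := hg.1
  have hreal : ∀ (j : Fin n) (s : ℝ) (y : Fin n → ℂ),
      g (y + Pi.single j (s : ℂ) + Pi.single k 1) - g (y + Pi.single j (s : ℂ)) = g (y + Pi.single k 1) - g y := by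
    intro j s y
    by_cases h : j = k
    · subst h
      have e : (Pi.single j (s : ℂ) : Fin n → ℂ) = s • Pi.single j 1 := by
        rw [← Pi.single_smul]; simp
      rw [e, add_assoc, show s • (Pi.single j 1 : Fin n → ℂ) + Pi.single j 1 = (s + 1) • Pi.single j 1 by module,
        bq_line hn hg y _ (by simp) s, bq_line hn hg y _ (by simp) (s + 1)]
      module
    · exact bq_trans hn hg y _ _ (by simp) (by simp [h]) (s * s) (by simp)
  have himne : ∀ (j k : Fin n), j ≠ k → ∀ (s : ℝ) (y : Fin n → ℂ),
      g (y + Pi.single j (s * Complex.I) + Pi.single k 1) - g (y + Pi.single j (s * Complex.I)) = g (y + Pi.single k 1) - g y := by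
    intro j k h s y
    refine bq_trans hn hg y _ _ (by simp) (by simp [h]) (-(s * s)) ?_
    simp
    linear_combination (s : ℂ) ^ 2 * Complex.I_sq
  have him : ∀ (j : Fin n) (s : ℝ) (y : Fin n → ℂ),
      g (y + Pi.single j (s * Complex.I) + Pi.single k 1) - g (y + Pi.single j (s * Complex.I)) = g (y + Pi.single k 1) - g y := by
    intro j s y
    by_cases h : j = k
    · subst h
      let b : Fin n → (Fin n → ℂ) := fun i => g (y + Pi.single i 1) - g y
      have hb1 : ∀ i, b i ⬝ᵥ b i = 1 := fun i => hg.2 _ _ (by simp)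
      have hb2 : ∀ i l, i ≠ l → b i ⬝ᵥ b l = 0 := fun i l hil => bq_orth hn hg y i l hil
      let z : ℝ → (Fin n → ℂ) := fun s => g (y + Pi.single j (s * Complex.I) + Pi.single j 1) - g (y + Pi.single j (s * Complex.I))
      have hsc : Continuous fun s : ℝ => (Pi.single j (s * Complex.I) : Fin n → ℂ) := by
        refine continuous_pi fun i => ?_
        simp only [Pi.single_apply]
        split_ifs <;> fun_prop
      have hzc : Continuous z := by fun_prop
      have hz : ∀ s, z s = (z s ⬝ᵥ b j) • b j := by
        intro s
        refine bq_expand b hb1 hb2 _ j fun l hl => ?_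
        have := bq_orth hn hg (y + Pi.single j (s * Complex.I)) j l hl.symm
        rw [himne j l hl.symm s y] at this
        exact this
      have hz1 : ∀ s, z s ⬝ᵥ z s = 1 := fun s => hg.2 _ _ (by simp)
      have hκ : ∀ s, z s ⬝ᵥ b j ∈ ({1, -1} : Set ℂ) := by
        intro s
        have h1 := hz1 s
        have h2 : z s ⬝ᵥ z s = (z s ⬝ᵥ b j) * (z s ⬝ᵥ b j) := by
          conv_lhs => rw [hz s]
          rw [smul_dotProduct, dotProduct_smul, hb1]; simp
        rw [h1] at h2
        exact mul_self_eq_one_iff.mp h2.symm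
      obtain ⟨c, -, hc⟩ := (isPreconnected_univ (α := ℝ)).eqOn_const_of_mapsTo
        (Set.toFinite ({1, -1} : Set ℂ)).isDiscrete (f := fun s => z s ⬝ᵥ b j) (by
          apply Continuous.continuousOn
          fun_prop)
        (fun θ _ => hκ θ) ⟨1, by simp⟩
      have e0 := hc (Set.mem_univ 0)
      have es := hc (Set.mem_univ s)
      have hz0 : z 0 = b j := by simp [z, b]
      simp only [Function.const_apply] at e0 es
      rw [hz0, hb1] at e0
      have := hz s
      rw [es, ← e0, one_smul] at this
      exact this
    · exact himne j k h s y
  have hall : ∀ v y : Fin n → ℂ, g (y + v + Pi.single k 1) - g (y + v) = g (y + Pi.single k 1) - g y := by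
    intro v
    rw [← Finset.univ_sum_single v]
    refine Finset.sum_induction _ (fun v => ∀ y, g (y + v + Pi.single k 1) - g (y + v) = g (y + Pi.single k 1) - g y) ?_ ?_ ?_
    · intro a b ha hb y
      rw [← add_assoc y a b, hb, ha]
    · intro y; simp
    · intro j _ y
      rw [← Complex.re_add_im (v j), Pi.single_add, ← add_assoc y, him, hreal]
  have := hall x 0
  simpa using this

lemma bq_const {n : ℕ} (hn : 2 ≤ n) {g} (hg : BQG n g) (x u : Fin n → ℂ) (hu : u ⬝ᵥ u = 1) :
    g (x + u) - g x = g u - g 0 := by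
  let i0 : Fin n := ⟨0, by omega⟩
  obtain ⟨U, hU, hUu⟩ := bq_householder (Pi.single i0 1) u (by simp [hu]) (by simp)
  obtain ⟨y, rfl⟩ := bq_surj U hU x
  have := bq_const_e hn (bq_comp hg U hU 0) i0 y
  simpa [hUu] using this

lemma bq_add {n : ℕ} (hn : 2 ≤ n) {g} (hg : BQG n g) (v x : Fin n → ℂ) :
    g (x + v) - g x = g v - g 0 := by
  have hadd : ∀ a b : Fin n → ℂ, (∀ x, g (x + a) - g x = g a - g 0) → (∀ x, g (x + b) - g x = g b - g 0) →
      (∀ x, g (x + (a + b)) - g x = g (a + b) - g 0) := by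
    intro a b ha hb x
    have h1 := hb (x + a)
    have h2 := hb a
    rw [← add_assoc, ← sub_add_sub_cancel _ (g (x + a)), h1, ← h2, ha]
    abel
  have hunit : ∀ u : Fin n → ℂ, u ⬝ᵥ u = 1 → ∀ r : ℝ, ∀ x, g (x + r • u) - g x = g (r • u) - g 0 := by
    intro u hu r x
    have := bq_line hn hg 0 u hu r
    rw [zero_add, zero_add] at this
    rw [bq_line hn hg x u hu, this, bq_const hn hg x u hu]; abel
  have hre : ∀ (j : Fin n) (s : ℝ) (x : Fin n → ℂ), g (x + Pi.single j (s : ℂ)) - g x = g (Pi.single j (s : ℂ)) - g 0 := by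
    intro j s
    have e : (Pi.single j (s : ℂ) : Fin n → ℂ) = s • Pi.single j 1 := by
      rw [← Pi.single_smul]; simp
    rw [e]
    exact hunit _ (by simp) s
  have him : ∀ (j : Fin n) (s : ℝ) (x : Fin n → ℂ), g (x + Pi.single j (s * Complex.I)) - g x = g (Pi.single j (s * Complex.I)) - g 0 := by
    intro j s
    have : Nontrivial (Fin n) := Fin.nontrivial_iff_two_le.mpr hn
    obtain ⟨k, hk⟩ := exists_ne j
    have s2'' : (((√2 : ℝ)) : ℂ) * (√2 : ℝ) = 2 := by exact_mod_cast Real.mul_self_sqrt (by norm_num : (0 : ℝ) ≤ 2)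
    have e : (Pi.single j (s * Complex.I) : Fin n → ℂ) =
        s • (Pi.single k ((√2 : ℝ) : ℂ) + Pi.single j Complex.I) + Pi.single k ((-(s * √2) : ℝ) : ℂ) := by
      rw [smul_add, ← Pi.single_smul, ← Pi.single_smul, add_right_comm, ← Pi.single_add]
      simp
    rw [e]
    refine hadd _ _ (hunit _ ?_ s) (hre k _)
    simp [dotProduct_add, hk, hk.symm]
    rw [s2'']; norm_num
  rw [← Finset.univ_sum_single v]
  refine Finset.sum_induction _ (fun v => ∀ x, g (x + v) - g x = g v - g 0) hadd ?_ ?_ x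
  · simp
  · intro j _
    rw [← Complex.re_add_im (v j), Pi.single_add]
    exact hadd _ _ (hre _ _) (him _ _)

lemma bq_linear {n : ℕ} (hn : 2 ≤ n) (L : (Fin n → ℂ) →ₗ[ℝ] (Fin n → ℂ))
    (hL : ∀ u, u ⬝ᵥ u = 1 → L u ⬝ᵥ L u = 1) :
    ∃ U : (Fin n → ℂ) →ₗ[ℂ] (Fin n → ℂ), (∀ x y, U x ⬝ᵥ U y = x ⬝ᵥ y) ∧
      ((∀ x, L x = U x) ∨ ∀ x, L x = U (fun i => (starRingEnd ℂ) (x i))) := by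
  let b : Fin n → (Fin n → ℂ) := fun i => L (Pi.single i 1)
  let c : Fin n → (Fin n → ℂ) := fun i => L (Pi.single i Complex.I)
  have hLs : ∀ (j : Fin n) (z : ℂ), L (Pi.single j z) = z.re • b j + z.im • c j := by
    intro j z
    simp only [b, c]
    rw [← map_smul, ← map_smul, ← map_add, ← Pi.single_smul, ← Pi.single_smul, ← Pi.single_add]
    simp
  have hb1 : ∀ i, b i ⬝ᵥ b i = 1 := fun i => hL _ (by simp)
  have hb2 : ∀ i j, i ≠ j → b i ⬝ᵥ b j = 0 := by
    intro i j hij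
    have := hL (Pi.single i (3 / 5 : ℝ) + Pi.single j (4 / 5 : ℝ)) (by
      simp [dotProduct_add, hij, hij.symm]; norm_num)
    rw [map_add, hLs, hLs] at this
    simp only [Complex.ofReal_re, Complex.ofReal_im, zero_smul, add_zero] at this
    simp only [smul_dotProduct, dotProduct_smul, add_dotProduct, dotProduct_add, hb1, Complex.real_smul] at this
    rw [dotProduct_comm (b j) (b i)] at this
    push_cast at this
    linear_combination (25/24) * this
  have hbc : ∀ k j, k ≠ j → b k ⬝ᵥ c j = 0 ∧ c j ⬝ᵥ c j = -1 := by
    intro k j hkj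
    have key : ∀ e : ℝ, e ^ 2 = 1 → (25/9 : ℂ) / 1 * (b k ⬝ᵥ b k) * (9/25) * (25/9) + 2 * (5/3) * e * (4/3) * (b k ⬝ᵥ c j) + (16/9) * (c j ⬝ᵥ c j) = 1 := by
      intro e he
      have he' : (e : ℂ) ^ 2 = 1 := by exact_mod_cast he
      have := hL (Pi.single k (5 / 3 : ℝ) + Pi.single j ((e * (4 / 3) : ℝ) * Complex.I)) (by
        simp [dotProduct_add, hkj, hkj.symm]
        linear_combination (16/9) * (e : ℂ) ^ 2 * Complex.I_sq - (16/9) * he')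
      rw [map_add, hLs, hLs] at this
      simp only [Complex.ofReal_re, Complex.ofReal_im, zero_smul, add_zero, Complex.mul_re, Complex.mul_im, Complex.I_re, Complex.I_im,
        mul_zero, mul_one, sub_zero, zero_mul, zero_add] at this
      simp only [smul_dotProduct, dotProduct_smul, add_dotProduct, dotProduct_add, Complex.real_smul] at this
      rw [dotProduct_comm (c j) (b k)] at this
      push_cast at this
      linear_combination this - (16/9) * (c j ⬝ᵥ c j) * he'
    have k1 := key 1 (by norm_num)
    have k2 := key (-1) (by norm_num)
    rw [hb1] at k1 k2
    push_cast at k1 k2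
    constructor
    · linear_combination (9/80) * k1 - (9/80) * k2
    · linear_combination (9/32) * k1 + (9/32) * k2
  have : Nontrivial (Fin n) := Fin.nontrivial_iff_two_le.mpr hn
  let a : Fin n → ℂ := fun j => c j ⬝ᵥ b j
  have hca : ∀ j, c j = a j • b j := fun j => bq_expand b hb1 hb2 (c j) j fun k hk => by
    rw [dotProduct_comm]; exact (hbc k j hk).1
  have ha : ∀ j, a j = Complex.I ∨ a j = -Complex.I := by
    intro j
    obtain ⟨k, hk⟩ := exists_ne j
    have h1 := (hbc k j hk).2
    rw [hca, smul_dotProduct, dotProduct_smul, hb1] at h1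
    simp only [smul_eq_mul, mul_one] at h1
    rw [← Complex.I_mul_I] at h1
    exact mul_self_eq_mul_self_iff.mp h1
  have hne : ∀ j k, a j = Complex.I → a k = -Complex.I → False := by
    intro j k hj hk
    have hjk : j ≠ k := by
      rintro rfl
      rw [hj] at hk
      have := congrArg Complex.im hk
      norm_num at this
    obtain ⟨y, hy⟩ := IsAlgClosed.exists_pow_nat_eq (1 - 2 * Complex.I) (n := 2) (by norm_num)
    have := hL (Pi.single j (1 + Complex.I) + Pi.single k y) (by
      simp [dotProduct_add, hjk, hjk.symm]
      linear_combination hy + Complex.I_sq)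
    rw [map_add, hLs, hLs, hca, hca, hj, hk] at this
    simp only [smul_dotProduct, dotProduct_smul, add_dotProduct, dotProduct_add, Complex.real_smul, hb1, hb2 j k hjk, hb2 k j hjk.symm, smul_eq_mul] at this
    simp only [Complex.add_re, Complex.add_im, Complex.one_re, Complex.one_im, Complex.I_re, Complex.I_im] at this
    have hre := congrArg Complex.re hy
    have him := congrArg Complex.im hy
    have him2 := congrArg Complex.im this
    simp [sq] at hre him him2
    linarith
  obtain ⟨U, hU, hUb⟩ := bq_on b hb1 hb2
  have hUs : ∀ (j : Fin n) (z : ℂ), U (Pi.single j z) = z • b j := by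
    intro j z
    rw [← hUb, ← map_smul, ← Pi.single_smul]; simp
  refine ⟨U, hU, ?_⟩
  by_cases hI : ∀ j, a j = Complex.I
  · left
    intro x
    rw [← Finset.univ_sum_single x, map_sum, map_sum]
    refine Finset.sum_congr rfl fun j _ => ?_
    rw [hLs, hUs, hca, hI]
    ext i
    simp
    linear_combination (b j i) * (Complex.re_add_im (x j))
  · right
    push Not at hI
    obtain ⟨k, hk⟩ := hI
    have hk := (ha k).resolve_left hk
    have hI : ∀ j, a j = -Complex.I := fun j => (ha j).resolve_left fun h => hne j k h hk
    intro x
    rw [← Finset.univ_sum_single (fun i => (starRingEnd ℂ) (x i))]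
    conv_lhs => rw [← Finset.univ_sum_single x]
    rw [map_sum, map_sum]
    refine Finset.sum_congr rfl fun j _ => ?_
    rw [hLs, hUs, hca, hI]
    ext i
    have : (starRingEnd ℂ) (x j) = (x j).re - (x j).im * Complex.I := by
      apply Complex.ext <;> simp
    simp [this]
    ring

end BQHelpers

/-- If n ≥ 2, d ∈ ℂ \ {0} and a continuous f : ℂⁿ → ℂⁿ preserves distance d,
then f = I ∘ (ρ,...,ρ) for some affine map I with orthogonal linear part and
ρ ∈ {id, τ_d}, where τ_d(x) = (d/τ(d))·τ(x). -/
theorem stmt_9 (n : ℕ) (hn : 2 ≤ n) (d : ℂ) (hd : d ≠ 0)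
    (f : (Fin n → ℂ) → (Fin n → ℂ)) (hcont : Continuous f)
    (hf : ∀ X Y : Fin n → ℂ, phi n X Y = d ^ 2 → phi n (f X) (f Y) = d ^ 2) :
    ∃ (I : (Fin n → ℂ) →ᵃ[ℂ] (Fin n → ℂ)) (ρ : ℂ → ℂ),
      (∀ X Y : Fin n → ℂ, phi n (I X) (I Y) = phi n X Y) ∧
      (ρ = id ∨ ρ = fun x => (d / (starRingEnd ℂ) d) * (starRingEnd ℂ) x) ∧
      (∀ X : Fin n → ℂ, f X = I (fun i => ρ (X i))) := by
  have hphi : ∀ X Y : Fin n → ℂ, phi n X Y = (X - Y) ⬝ᵥ (X - Y) := by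
    intro X Y
    simp [phi, dotProduct, sq]
  simp only [hphi] at hf ⊢
  have hg : BQG n (fun w => d⁻¹ • f (d • w)) := by
    refine ⟨by fun_prop, fun x y hxy => ?_⟩
    have h := hf (d • x) (d • y) (by
      rw [← smul_sub, smul_dotProduct, dotProduct_smul, hxy]; simp [sq])
    rw [← smul_sub, smul_dotProduct, dotProduct_smul, h]
    simp only [smul_eq_mul]
    field_simp
  set g : (Fin n → ℂ) → (Fin n → ℂ) := fun w => d⁻¹ • f (d • w) with hgd
  have hgc := hg.1
  let L0 : (Fin n → ℂ) →+ (Fin n → ℂ) := AddMonoidHom.mk' (fun v => g v - g 0) (by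
    intro a b
    have := bq_add hn hg b a
    rw [← sub_add_sub_cancel _ (g a), this]; abel)
  have hL0 : Continuous L0 := by
    change Continuous fun v => g v - g 0
    fun_prop
  obtain ⟨U, hU, hor⟩ := bq_linear hn (L0.toRealLinearMap hL0).toLinearMap (by
    intro u hu
    exact hg.2 u 0 (by simpa using hu))
  have hfX : ∀ X, f X = d • (g (d⁻¹ • X) - g 0) + d • g 0 := by
    intro X
    rw [← smul_add, sub_add_cancel, hgd]
    simp only [smul_inv_smul₀ hd]
  have hI : ∀ X : Fin n → ℂ, (U.toAffineMap + AffineMap.const ℂ (Fin n → ℂ) (d • g 0)) X = U X + d • g 0 :=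
    fun X => rfl
  have hiso : ∀ X Y : Fin n → ℂ, ((U.toAffineMap + AffineMap.const ℂ (Fin n → ℂ) (d • g 0)) X -
      (U.toAffineMap + AffineMap.const ℂ (Fin n → ℂ) (d • g 0)) Y) ⬝ᵥ
      ((U.toAffineMap + AffineMap.const ℂ (Fin n → ℂ) (d • g 0)) X -
      (U.toAffineMap + AffineMap.const ℂ (Fin n → ℂ) (d • g 0)) Y) = (X - Y) ⬝ᵥ (X - Y) := by
    intro X Y
    rw [hI, hI, add_sub_add_right_eq_sub, ← map_sub, hU]
  rcases hor with h | h
  · refine ⟨_, id, hiso, Or.inl rfl, fun X => ?_⟩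
    have h1 : g (d⁻¹ • X) - g 0 = U (d⁻¹ • X) := h _
    rw [hI, hfX, h1, map_smul, smul_inv_smul₀ hd]
    rfl
  · refine ⟨_, fun x => (d / (starRingEnd ℂ) d) * (starRingEnd ℂ) x, hiso, Or.inr rfl, fun X => ?_⟩
    have h1 : g (d⁻¹ • X) - g 0 = U (fun i => (starRingEnd ℂ) ((d⁻¹ • X) i)) := h _
    rw [hI, hfX, h1, ← map_smul]
    congr 2
    ext i
    simp [div_eq_mul_inv]
    ring
end
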